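/- The L_NFU-sentence asserting: for every n ∈ ℕ, if beth(n) ≠ ∅ and beth(n) ≤ T⁴(|V|), then for every set B ⊆ M_n there exists 𝔡 ∈ M_{n+1} such that for all 𝔟 ∈ M_n, 𝔟 E 𝔡 if and only if 𝔟 ∈ B, holds in every model of NFU^{-AC} (V the universal set, T⁴ the fourth iterate of T, M_n = E^{ω+n}, and κ ≤ μ meaning there are X ∈ κ, Y ∈ μ with an injection from X into Y). -/

import Mathlib

open FirstOrder Language

namespace NFUweak

/-! ## The language L_NFU -/

/-- Function symbols of `L_NFU`: a single binary (type-level) pairing function. -/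
inductive NFUFunc : ℕ → Type
  | pair : NFUFunc 2

/-- Relation symbols of `L_NFU`: binary membership `∈` and unary sethood `S`. -/
inductive NFURel : ℕ → Type
  | mem : NFURel 2
  | isSet : NFURel 1

/-- The language `L_NFU`. -/
def LNFU : Language := ⟨NFUFunc, NFURel⟩

/-- The membership relation symbol. -/
def memR : LNFU.Relations 2 := NFURel.mem

/-- The sethood relation symbol. -/
def setR : LNFU.Relations 1 := NFURel.isSet

/-- The pairing function symbol. -/
def pairF : LNFU.Functions 2 := NFUFunc.pair

/-! ## Stratification -/

/-- `termLevel σ t k` says that, relative to the assignment `σ` of levels (types)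
to variables, the term `t` (and all of its subterms) receives level `k`. -/
def termLevel {α : Type} (σ : α → ℕ) : LNFU.Term α → ℕ → Prop
  | Term.var v, k => σ v = k
  | Term.func _ ts, k => ∀ i, termLevel σ (ts i) k

/-- The stratification condition on an atomic formula `R(ts)`:
for `s ∈ t` the level of `t` is one more than that of `s`; `S(t)` imposes only
that `t` has a well-defined level. -/
def atomOK {α : Type} (σ : α → ℕ) : ∀ {l : ℕ}, LNFU.Relations l → (Fin l → LNFU.Term α) → Prop
  | _, NFURel.mem, ts => ∃ k, termLevel σ (ts 0) k ∧ termLevel σ (ts 1) (k + 1)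
  | _, NFURel.isSet, ts => ∃ k, termLevel σ (ts 0) k

/-- `stratifiedFrom σ φ` : the formula `φ` is stratified, where the free
variables receive the levels given by `σ` (each quantified variable may receive
any level). -/
def stratifiedFrom : ∀ {n : ℕ}, ((Empty ⊕ Fin n) → ℕ) → LNFU.BoundedFormula Empty n → Prop
  | _, _, BoundedFormula.falsum => True
  | _, σ, BoundedFormula.equal t s => ∃ k, termLevel σ t k ∧ termLevel σ s k
  | _, σ, BoundedFormula.rel R ts => atomOK σ R ts
  | _, σ, BoundedFormula.imp f g => stratifiedFrom σ f ∧ stratifiedFrom σ g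
  | _, σ, BoundedFormula.all f =>
      ∃ k, stratifiedFrom
        (Sum.elim (fun e => σ (Sum.inl e)) (Fin.snoc (fun i => σ (Sum.inr i)) k)) f

/-- A formula of `L_NFU` is stratified if some assignment of levels to its
variables witnesses the stratification conditions. -/
def IsStratified {n : ℕ} (φ : LNFU.BoundedFormula Empty n) : Prop :=
  ∃ σ, stratifiedFrom σ φ

/-! ## The axioms of NFU⁻ᴬᶜ -/

/-- Weak extensionality: sets with the same members are equal. -/
def weakExtAx : LNFU.Sentence :=
  ∀' ∀' ((setR.boundedFormula₁ &0 ⊓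
          setR.boundedFormula₁ &1) ⟹
    (Term.bdEqual &0 &1 ⇔
      ∀' (memR.boundedFormula₂ &2 &0 ⇔
          memR.boundedFormula₂ &2 &1)))

/-- The pairing axiom: `⟨x,y⟩ = ⟨w,z⟩ → x = w ∧ y = z`. -/
def pairingAx : LNFU.Sentence :=
  ∀' ∀' ∀' ∀' (Term.bdEqual
      (pairF.apply₂ &0 &1)
      (pairF.apply₂ &2 &3) ⟹
    (Term.bdEqual &0 &2 ⊓ Term.bdEqual &1 &3))

/-- The comprehension axiom for a formula `φ(x, z₀, …, z_{m-1})`, where the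
variable `x` is (de Bruijn) variable `m` of `φ` and `z₀, …, z_{m-1}` are the
parameters: `∀ z⃗ ∃ y (S(y) ∧ ∀ x (x ∈ y ↔ φ(x, z⃗)))`. -/
def comprehensionAx (m : ℕ) (φ : LNFU.BoundedFormula Empty (m + 1)) : LNFU.Sentence :=
  BoundedFormula.alls (∃'
    (setR.boundedFormula₁ (Term.var (Sum.inr ⟨m, by omega⟩)) ⊓
      ∀' (memR.boundedFormula₂
            (Term.var (Sum.inr ⟨m + 1, by omega⟩)) (Term.var (Sum.inr ⟨m, by omega⟩)) ⇔
          φ.liftAt 1 m)))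

/-- The theory NFU⁻ᴬᶜ : weak extensionality, pairing and stratified comprehension. -/
def NFUmAC : LNFU.Theory :=
  {weakExtAx, pairingAx} ∪
    {s | ∃ (m : ℕ) (φ : LNFU.BoundedFormula Empty (m + 1)),
      IsStratified φ ∧ s = comprehensionAx m φ}

/-- The axiom `∀x S(x)` ("everything is a set"), turning NFU⁻ᴬᶜ into NF. -/
def allSetAx : LNFU.Sentence :=
  ∀' (setR.boundedFormula₁ &0)

/-- The theory NF. -/
def NF : LNFU.Theory := NFUmAC ∪ {allSetAx}

end NFUweak
namespace NFUweak

/-! ## Semantic notions inside a model of NFU⁻ᴬᶜ -/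

section Semantics

variable {M : Type} [LNFU.Structure M]

/-- The membership relation of the model. -/
def smem (x y : M) : Prop := Structure.RelMap memR ![x, y]

/-- The sethood predicate of the model. -/
def sset (x : M) : Prop := Structure.RelMap setR ![x]

/-- The (type-level) pairing function of the model. -/
def spair (x y : M) : M := Structure.funMap pairF ![x, y]

/-- `s` is the singleton `{x}`. -/
def isSingletonOf (s x : M) : Prop := sset s ∧ ∀ z, smem z s ↔ z = x

/-- `e` is the empty set. -/
def isEmptySet (e : M) : Prop := sset e ∧ ∀ z, ¬ smem z e

/-- `v` is the universal set `V`. -/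
def isUniverseOf (v : M) : Prop := sset v ∧ ∀ x, smem x v

/-- `f` is an internal function from (the members of) `X` to `Y`, coded as a set of
type-level ordered pairs `⟨a, b⟩`. -/
def isFunc (f X Y : M) : Prop :=
  sset f ∧ (∀ p, smem p f → ∃ a b, p = spair a b ∧ smem a X ∧ smem b Y) ∧
    (∀ a, smem a X → ∃ b, smem (spair a b) f) ∧
    (∀ a b b', smem (spair a b) f → smem (spair a b') f → b = b')

/-- `f` is an internal injection from `X` into `Y`. -/
def isInjFunc (f X Y : M) : Prop :=
  isFunc f X Y ∧ ∀ a a' b, smem (spair a b) f → smem (spair a' b) f → a = a'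

/-- `f` is an internal bijection between `X` and `Y`. -/
def isBijFunc (f X Y : M) : Prop :=
  isInjFunc f X Y ∧ ∀ b, smem b Y → ∃ a, smem (spair a b) f

/-- `X` and `Y` are equipollent (internally). -/
def equipollent (X Y : M) : Prop := ∃ f, isBijFunc f X Y

/-- `c` is the cardinal `|X|`, i.e. the equivalence class of `X` under equipollence. -/
def isCardOf (c X : M) : Prop := sset c ∧ ∀ y, smem y c ↔ equipollent y X

/-- `c` is a cardinal. -/
def isCardinal (c : M) : Prop := ∃ X, sset X ∧ isCardOf c X

/-- `κ ≤ μ` for cardinals: some member of `κ` injects into some member of `μ`. -/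
def cardLe (κ μ : M) : Prop := ∃ X Y f, smem X κ ∧ smem Y μ ∧ isInjFunc f X Y

/-- `Y = ι``X` is the set of singletons of members of `X`. -/
def isIotaImageOf (Y X : M) : Prop :=
  sset Y ∧ ∀ z, smem z Y ↔ ∃ x, smem x X ∧ isSingletonOf z x

/-- `t = T(c)` for a cardinal `c`:  `T(|X|) = |ι``X|`. -/
def isTOf (t c : M) : Prop :=
  ∃ X Y, smem X c ∧ isIotaImageOf Y X ∧ isCardOf t Y

/-- `t = T⁴(c)`. -/
def isT4Of (t c : M) : Prop :=
  ∃ t₁ t₂ t₃, isTOf t₁ c ∧ isTOf t₂ t₁ ∧ isTOf t₃ t₂ ∧ isTOf t t₃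

/-- `z` is the cardinal `0`, the set of all objects with no members. -/
def isZeroCard (z : M) : Prop := sset z ∧ ∀ y, smem y z ↔ ∀ w, ¬ smem w y

/-- `s = S(x)` is the cardinal successor:  `S(x) = {y : (∃z∈y)(y∖{z} ∈ x)}`. -/
def isSuccOf (s x : M) : Prop :=
  sset s ∧ ∀ y, smem y s ↔
    ∃ z, smem z y ∧ ∃ d, sset d ∧ (∀ w, smem w d ↔ (smem w y ∧ w ≠ z)) ∧ smem d x

/-- `o` is the cardinal `1 = S(0)`. -/
def isOneCard (o : M) : Prop := ∃ z, isZeroCard z ∧ isSuccOf o z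

/-- `I` is an inductive set: it contains `0` and is closed under `S`. -/
def isInductiveSet (I : M) : Prop :=
  sset I ∧ (∀ z, isZeroCard z → smem z I) ∧ ∀ a b, smem a I → isSuccOf b a → smem b I

/-- `n` is an internal natural number: it belongs to every inductive set. -/
def isNat (n : M) : Prop := ∀ I, isInductiveSet I → smem n I

/-- `N` is the set `ℕ` of internal natural numbers. -/
def isNatSet (N : M) : Prop := sset N ∧ ∀ y, smem y N ↔ isNat y

/-- `m + k = n` on cardinals, via disjoint unions. -/
def cardAdd (m k n : M) : Prop :=
  ∃ x y u, smem x m ∧ smem y k ∧ (∀ w, ¬ (smem w x ∧ smem w y)) ∧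
    sset u ∧ (∀ w, smem w u ↔ (smem w x ∨ smem w y)) ∧ smem u n

/-- `P` is the cartesian product `x × y` (with type-level pairs). -/
def isProdOf (P x y : M) : Prop :=
  sset P ∧ ∀ p, smem p P ↔ ∃ a b, smem a x ∧ smem b y ∧ p = spair a b

/-- `k · m = n` on cardinals, via cartesian products. -/
def cardMul (k m n : M) : Prop :=
  ∃ x y P, smem x k ∧ smem y m ∧ isProdOf P x y ∧ smem P n

/-- `m ≤ n` on internal natural numbers: `∃k∈ℕ, m + k = n`. -/
def natLe (m n : M) : Prop := ∃ k, isNat k ∧ cardAdd m k n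

/-- The model satisfies `AxCount₍≥₎ : (∀n∈ℕ)(T(n) ≤ n)`. -/
def axCountGeqHolds (M : Type) [LNFU.Structure M] : Prop :=
  ∀ n : M, isNat n → ∀ t, isTOf t n → natLe t n

/-- The model satisfies `AxCount₍≤₎ : (∀n∈ℕ)(n ≤ T(n))`. -/
def axCountLeqHolds (M : Type) [LNFU.Structure M] : Prop :=
  ∀ n : M, isNat n → ∀ t, isTOf t n → natLe n t

/-- The model satisfies `AxCount : (∀n∈ℕ)(T(n) = n)`. -/
def axCountHolds (M : Type) [LNFU.Structure M] : Prop :=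
  ∀ n : M, isNat n → ∀ t, isTOf t n → t = n

/-- The model satisfies the Axiom of Choice: every set of pairwise disjoint
nonempty sets has a transversal. -/
def acHolds (M : Type) [LNFU.Structure M] : Prop :=
  ∀ X : M, sset X →
    (∀ y, smem y X → sset y ∧ ∃ z, smem z y) →
    (∀ y y', smem y X → smem y' X → y ≠ y' → ∀ z, ¬ (smem z y ∧ smem z y')) →
    ∃ t, sset t ∧ ∀ y, smem y X → ∃! z, smem z y ∧ smem z t

/-- `2^κ` is defined (i.e. `2^κ ≠ ∅`): there is a set `X` with `|ι``X| = κ`. -/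
def twoPowDefined (κ : M) : Prop := ∃ X Y, isIotaImageOf Y X ∧ isCardOf κ Y

/-- `P` is the power set of `X`. -/
def isPowerSetOf (P X : M) : Prop :=
  sset P ∧ ∀ z, smem z P ↔ (sset z ∧ ∀ w, smem w z → smem w X)

/-- `μ = 2^κ` (in the nonempty case): `μ = |P(X)|` for some `X` with `|ι``X| = κ`. -/
def isTwoPowOf (μ κ : M) : Prop :=
  ∃ X Y P, isIotaImageOf Y X ∧ isCardOf κ Y ∧ isPowerSetOf P X ∧ isCardOf μ P

/-- `f` is the internal function `beth : ℕ → NC ∪ {∅}` with `beth(0) = ℵ₀` and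
`beth(n+1) = 2^{beth(n)}` (with value `∅` once undefined). -/
def isBethFun (f : M) : Prop :=
  sset f ∧
    (∀ p, smem p f → ∃ n y, isNat n ∧ p = spair n y) ∧
    (∀ n, isNat n → ∃ y, smem (spair n y) f) ∧
    (∀ n y y', smem (spair n y) f → smem (spair n y') f → y = y') ∧
    (∀ z y, isZeroCard z → smem (spair z y) f → ∃ N, isNatSet N ∧ isCardOf y N) ∧
    (∀ n n' y y', isNat n → isSuccOf n' n →
      smem (spair n y) f → smem (spair n' y') f →
        ((isEmptySet y ∧ isEmptySet y') ∨
          (¬ isEmptySet y ∧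
            (isTwoPowOf y' y ∨ (isEmptySet y' ∧ ¬ twoPowDefined y)))))

end Semantics

end NFUweak
namespace NFUweak

/-! ## BFEXTs and the structure ⟨BF, E⟩ inside a model of NFU⁻ᴬᶜ -/

section BF

variable {M : Type} [LNFU.Structure M]

/-- `R` is an internal binary relation: a set of (type-level) ordered pairs. -/
def isRel (R : M) : Prop := sset R ∧ ∀ p, smem p R → ∃ x y, p = spair x y

/-- `x` belongs to the field `Dom(R) = dom(R) ∪ rng(R)` of the relation `R`. -/
def inField (x R : M) : Prop := ∃ y, smem (spair x y) R ∨ smem (spair y x) R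

/-- `D` is the field `Dom(R)` of `R`, as a set. -/
def isFieldSetOf (D R : M) : Prop := sset D ∧ ∀ x, smem x D ↔ inField x R

/-- `R` is a BFEXT: a binary relation that is well-founded (every nonempty
subset of its field has an `R`-minimal element) and extensional. -/
def isBFEXT (R : M) : Prop :=
  isRel R ∧
    (∀ B, sset B → (∃ b, smem b B) → (∀ b, smem b B → inField b R) →
      ∃ b, smem b B ∧ ∀ c, smem c B → ¬ smem (spair c b) R) ∧
    (∀ a b, inField a R → inField b R →
      (∀ c, smem (spair c a) R ↔ smem (spair c b) R) → a = b)

/-- `x` belongs to the smallest subset of `Dom(R)` containing `a` and closed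
under `R`-predecessors. -/
def inSeg (x R a : M) : Prop :=
  ∀ B, sset B → (∀ b, smem b B → inField b R) → smem a B →
    (∀ b c, smem b B → smem (spair c b) R → smem c B) → smem x B

/-- `s = seg_R(a)`: the restriction of `R` to the smallest subset of `Dom(R)`
containing `a` and closed under `R`-predecessors. -/
def isSegOf (s R a : M) : Prop :=
  sset s ∧ ∀ p, smem p s ↔
    (smem p R ∧ ∃ x y, p = spair x y ∧ inSeg x R a ∧ inSeg y R a)

/-- `R ∈ Ω`: `R` is a BFEXT with `R = seg_R(a)` for some `a ∈ Dom(R)`. -/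
def inOmega (R : M) : Prop := isBFEXT R ∧ ∃ a, inField a R ∧ isSegOf R R a

/-- `a = 1_R` is the (unique) top of `R ∈ Ω`. -/
def isTopOf (a R : M) : Prop := inField a R ∧ isSegOf R R a

/-- `f` is an internal isomorphism between the relations `R` and `S`. -/
def isIsoRel (f R S : M) : Prop :=
  sset f ∧
    (∀ p, smem p f → ∃ x y, p = spair x y ∧ inField x R ∧ inField y S) ∧
    (∀ x, inField x R → ∃ y, smem (spair x y) f) ∧
    (∀ x y y', smem (spair x y) f → smem (spair x y') f → y = y') ∧
    (∀ x x' y, smem (spair x y) f → smem (spair x' y) f → x = x') ∧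
    (∀ y, inField y S → ∃ x, smem (spair x y) f) ∧
    (∀ x y x' y', smem (spair x x') f → smem (spair y y') f →
      (smem (spair x y) R ↔ smem (spair x' y') S))

/-- `R` and `S` are isomorphic relations. -/
def relIso (R S : M) : Prop := ∃ f, isIsoRel f R S

/-- `t = [R]` is the set of all relations isomorphic to `R`. -/
def isTypeOf (t R : M) : Prop := sset t ∧ ∀ S, smem S t ↔ relIso S R

/-- `a ∈ BF`: `a = [R]` for some `R ∈ Ω`. -/
def inBF (a : M) : Prop := ∃ R, inOmega R ∧ isTypeOf a R

/-- `a E b` for `a, b ∈ BF`: for `R ∈ a`, `S ∈ b` there is `x ∈ Dom(S)` with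
`⟨x, 1_S⟩ ∈ S` and `R ≅ seg_S(x)`. -/
def erel (a b : M) : Prop :=
  ∃ R S, smem R a ∧ smem S b ∧
    ∃ x oneS, isTopOf oneS S ∧ smem (spair x oneS) S ∧
      ∃ sg, isSegOf sg S x ∧ relIso R sg

/-- `e` is the set `E ⊆ BF × BF`. -/
def isESet (e : M) : Prop :=
  sset e ∧ ∀ p, smem p e ↔ ∃ a b, p = spair a b ∧ inBF a ∧ inBF b ∧ erel a b

/-- `R' = T(R)`: the relation `{⟨{x},{y}⟩ : ⟨x,y⟩ ∈ R}`. -/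
def isTRelOf (R' R : M) : Prop :=
  sset R' ∧ ∀ p, smem p R' ↔
    ∃ x y sx sy, smem (spair x y) R ∧ isSingletonOf sx x ∧ isSingletonOf sy y ∧
      p = spair sx sy

/-- `t' = T(t)` for (isomorphism) types `t` of well-founded relations:
`T([R]) = [{⟨{x},{y}⟩ : ⟨x,y⟩ ∈ R}]`. -/
def isTTypeOf (t' t : M) : Prop :=
  ∃ R R', smem R t ∧ isTRelOf R' R ∧ isTypeOf t' R'

/-- `y = M₀ = E^ω`, the set of types of BFEXTs with finite domain. -/
def isM0Set (y : M) : Prop :=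
  sset y ∧ ∀ a, smem a y ↔
    (inBF a ∧ ∃ R D c, smem R a ∧ isFieldSetOf D R ∧ isCardOf c D ∧ isNat c)

/-- `g` is the internal function `n ↦ M_n = E^{ω+n}` on the internal naturals:
`M_0 = E^ω` and `M_{n+1} = {a ∈ BF : every E-predecessor of a lies in M_n}`. -/
def isMFun (g : M) : Prop :=
  sset g ∧
    (∀ p, smem p g → ∃ n y, isNat n ∧ p = spair n y) ∧
    (∀ n, isNat n → ∃ y, smem (spair n y) g) ∧
    (∀ n y y', smem (spair n y) g → smem (spair n y') g → y = y') ∧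
    (∀ z y, isZeroCard z → smem (spair z y) g → isM0Set y) ∧
    (∀ n n' y y', isNat n → isSuccOf n' n →
      smem (spair n y) g → smem (spair n' y') g →
        (sset y' ∧ ∀ a, smem a y' ↔ (inBF a ∧ ∀ b, inBF b → erel b a → smem b y)))

end BF

end NFUweak
namespace NFUweak

/-! ## The Simple Theory of Types with Infinity (TSTI) -/

/-- Formulae of the many-sorted language `L_TST`, with named variables:
`mem n i j` is `x^n_i ∈_n x^{n+1}_j`, `eq n i j` is `x^n_i = x^n_j`, and
`all n i φ` is `∀ x^n_i, φ`. -/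
inductive TSTFormula : Type
  | mem (n i j : ℕ)
  | eq (n i j : ℕ)
  | fal
  | imp (φ ψ : TSTFormula)
  | all (n i : ℕ) (φ : TSTFormula)

/-- Update a many-sorted valuation at variable `x^n_i`. -/
def tstUpd {M : ℕ → Type} (v : ∀ n, ℕ → M n) (n i : ℕ) (a : M n) : ∀ m, ℕ → M m :=
  fun m j => if h : m = n ∧ j = i then (congrArg M h.1).symm ▸ a else v m j

/-- Satisfaction of an `L_TST`-formula in the many-sorted structure `⟨M, E⟩`
under the valuation `v`. -/
def TSTFormula.Realize {M : ℕ → Type} (E : ∀ n, M n → M (n + 1) → Prop) :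
    TSTFormula → (∀ n, ℕ → M n) → Prop
  | .mem n i j, v => E n (v n i) (v (n + 1) j)
  | .eq n i j, v => v n i = v n j
  | .fal, _ => False
  | .imp φ ψ, v => φ.Realize E v → ψ.Realize E v
  | .all n i φ, v => ∀ a : M n, φ.Realize E (tstUpd v n i a)

/-- All sorts mentioned in the formula are `< k` (so it is an `L_k`-formula). -/
def TSTFormula.sortsLT : TSTFormula → ℕ → Prop
  | .mem n _ _, k => n + 1 < k
  | .eq n _ _, k => n < k
  | .fal, _ => True
  | .imp φ ψ, k => φ.sortsLT k ∧ ψ.sortsLT k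
  | .all n _ φ, k => n < k ∧ φ.sortsLT k

/-- `p : M 2` is the Kuratowski ordered pair `⟨a, b⟩ = {{a},{a,b}}`. -/
def isKPair {M : ℕ → Type} (E : ∀ n, M n → M (n + 1) → Prop)
    (p : M 2) (a b : M 0) : Prop :=
  ∀ s : M 1, E 1 s p ↔
    ((∀ z, E 0 z s ↔ z = a) ∨ (∀ z, E 0 z s ↔ (z = a ∨ z = b)))

/-- The axiom of Infinity: there are `x¹` and `f³` such that `f³` codes an
injective, non-surjective function from `x¹` to `x¹` (with Kuratowski pairs). -/
def TSTInfinity {M : ℕ → Type} (E : ∀ n, M n → M (n + 1) → Prop) : Prop :=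
  ∃ (X : M 1) (f : M 3),
    (∀ p : M 2, E 2 p f → ∃ a b, E 0 a X ∧ E 0 b X ∧ isKPair E p a b) ∧
    (∀ a, E 0 a X → ∃ b p, E 0 b X ∧ E 2 p f ∧ isKPair E p a b) ∧
    (∀ a b b' p p', E 2 p f → E 2 p' f → isKPair E p a b → isKPair E p' a b' → b = b') ∧
    (∀ a a' b p p', E 2 p f → E 2 p' f → isKPair E p a b → isKPair E p' a' b → a = a') ∧
    (∃ b, E 0 b X ∧ ∀ a p, E 2 p f → ¬ isKPair E p a b)

/-- `⟨M, E⟩` is a model of TSTI: all sorts are nonempty and Extensionality,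
Comprehension (for every `L_TST`-formula) and Infinity hold. -/
def IsTSTIModel (M : ℕ → Type) (E : ∀ n, M n → M (n + 1) → Prop) : Prop :=
  (∀ n, Nonempty (M n)) ∧
    (∀ n, ∀ x y : M (n + 1), (∀ z, E n z x ↔ E n z y) → x = y) ∧
    (∀ (φ : TSTFormula) (n i : ℕ) (v : ∀ m, ℕ → M m),
      ∃ y : M (n + 1), ∀ x : M n, E n x y ↔ φ.Realize E (tstUpd v n i x)) ∧
    TSTInfinity E

/-- `⟨M, E⟩` is a model of the fragment TSTI_k, which only refers to the sorts
`< k` (so `k ≥ 4` is needed for the axiom of Infinity to be expressible). -/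
def IsTSTIModelBelow (k : ℕ) (M : ℕ → Type) (E : ∀ n, M n → M (n + 1) → Prop) : Prop :=
  (∀ n, n < k → Nonempty (M n)) ∧
    (∀ n, n + 1 < k → ∀ x y : M (n + 1), (∀ z, E n z x ↔ E n z y) → x = y) ∧
    (∀ (φ : TSTFormula), φ.sortsLT k → ∀ (n i : ℕ), n + 1 < k →
      ∀ v : ∀ m, ℕ → M m,
        ∃ y : M (n + 1), ∀ x : M n, E n x y ↔ φ.Realize E (tstUpd v n i x)) ∧
    TSTInfinity E

/-! ## The language of arithmetic and the internal arithmetic of a model -/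

/-- Function symbols of `L_PA`: `0`, `1`, `+` and `·`. -/
inductive PAFunc : ℕ → Type
  | zero : PAFunc 0
  | one : PAFunc 0
  | add : PAFunc 2
  | mul : PAFunc 2

/-- The language `L_PA` of arithmetic. -/
def LPA : Language := ⟨PAFunc, fun _ => Empty⟩

/-- The type of internal natural numbers of a model of NFU⁻ᴬᶜ. -/
def NatSub (M : Type) [LNFU.Structure M] : Type := {n : M // isNat n}

/-- An `L_PA`-structure on the internal natural numbers of `M` is the internal
arithmetic if its operations are given by the internal graphs of `0`, `1`,
cardinal addition and cardinal multiplication. -/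
def InternalArithOn (M : Type) [LNFU.Structure M] (A : LPA.Structure (NatSub M)) : Prop :=
  isZeroCard (A.funMap PAFunc.zero ![]).val ∧
    isOneCard (A.funMap PAFunc.one ![]).val ∧
    (∀ a b : NatSub M, cardAdd a.val b.val (A.funMap PAFunc.add ![a, b]).val) ∧
    (∀ a b : NatSub M, cardMul a.val b.val (A.funMap PAFunc.mul ![a, b]).val)

/-- `φ^ℕ` holds in `M`: the sentence `φ` of `L_PA` is true in the internal
arithmetic `⟨ℕ, +, ·, 0, 1⟩` of `M`. -/
def internalPASat (M : Type) [LNFU.Structure M] (φ : LPA.Sentence) : Prop :=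
  ∀ A : LPA.Structure (NatSub M), InternalArithOn M A →
    @Sentence.Realize LPA (NatSub M) A φ

end NFUweak
namespace NFUweak

/-! ## A shallow framework for stratified comprehension -/

section Framework

variable {M : Type} [LNFU.Structure M]

/-- Push a value in front of an environment. -/
def ncons {A : Type} (x : A) (v : ℕ → A) : ℕ → A
  | 0 => x
  | n + 1 => v n

/-- `STm σ k t`: `t` is a stratified term of level `k`; parameters may have any level. -/
inductive STm (σ : ℕ → ℕ) : ℕ → ((ℕ → M) → M) → Prop
  | var (i : ℕ) : STm σ (σ i) (fun v => v i)
  | const (a : M) (k : ℕ) : STm σ k (fun _ => a)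
  | pair {k : ℕ} {s t : (ℕ → M) → M} (hs : STm σ k s) (ht : STm σ k t) :
      STm σ k (fun v => spair (s v) (t v))

/-- `SF σ P`: the predicate `P` is given by a stratified formula with parameters. -/
inductive SF : (ℕ → ℕ) → ((ℕ → M) → Prop) → Prop
  | fls {σ : ℕ → ℕ} : SF σ (fun _ => False)
  | eq {σ : ℕ → ℕ} {k : ℕ} {s t : (ℕ → M) → M} (hs : STm σ k s) (ht : STm σ k t) :
      SF σ (fun v => s v = t v)
  | mem {σ : ℕ → ℕ} {k : ℕ} {s t : (ℕ → M) → M} (hs : STm σ k s) (ht : STm σ (k + 1) t) :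
      SF σ (fun v => smem (s v) (t v))
  | set {σ : ℕ → ℕ} {k : ℕ} {s : (ℕ → M) → M} (hs : STm σ k s) : SF σ (fun v => sset (s v))
  | imp {σ : ℕ → ℕ} {P Q : (ℕ → M) → Prop} (hP : SF σ P) (hQ : SF σ Q) :
      SF σ (fun v => P v → Q v)
  | all {σ : ℕ → ℕ} {k : ℕ} {Q : (ℕ → M) → M → Prop}
      (h : SF (ncons k σ) (fun w => Q (fun i => w (i + 1)) (w 0))) :
      SF σ (fun v => ∀ x, Q v x)

theorem STm.wk {σ : ℕ → ℕ} {j k : ℕ} {s : (ℕ → M) → M} (h : STm σ k s) :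
    STm (ncons j σ) k (fun w => s (fun i => w (i + 1))) := by
  induction h with
  | var i => exact STm.var (σ := ncons j σ) (i + 1)
  | const a k => exact STm.const a k
  | pair _ _ h1 h2 => exact STm.pair h1 h2

theorem STm.subst {σ σ' : ℕ → ℕ} {k : ℕ} {s : (ℕ → M) → M} (h : STm σ' k s)
    (θ : ℕ → (ℕ → M) → M) (hθ : ∀ i, STm σ (σ' i) (θ i)) :
    STm σ k (fun v => s (fun i => θ i v)) := by
  induction h with
  | var i => exact hθ i
  | const a k => exact STm.const a k
  | pair _ _ h1 h2 => exact STm.pair h1 h2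

theorem SF.subst {σ' : ℕ → ℕ} {P : (ℕ → M) → Prop} (h : SF σ' P) :
    ∀ {σ : ℕ → ℕ} (θ : ℕ → (ℕ → M) → M), (∀ i, STm σ (σ' i) (θ i)) →
    SF σ (fun v => P (fun i => θ i v)) := by
  induction h with
  | fls => intro σ θ _; exact SF.fls
  | eq hs ht => intro σ θ hθ; exact SF.eq (hs.subst θ hθ) (ht.subst θ hθ)
  | mem hs ht => intro σ θ hθ; exact SF.mem (hs.subst θ hθ) (ht.subst θ hθ)
  | set hs => intro σ θ hθ; exact SF.set (hs.subst θ hθ)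
  | imp _ _ h1 h2 => intro σ θ hθ; exact SF.imp (h1 θ hθ) (h2 θ hθ)
  | @all σ' k Q _ ih =>
    intro σ θ hθ
    refine SF.all (k := k) (Q := fun v x => Q (fun i => θ i v) x) ?_
    have := ih (σ := ncons k σ)
      (ncons (fun w => w 0) (fun i w => θ i (fun j => w (j + 1)))) (by
        intro i
        cases i with
        | zero => exact STm.var (σ := ncons k σ) 0
        | succ i => exact (hθ i).wk)
    exact this

theorem SF.congr {σ : ℕ → ℕ} {P Q : (ℕ → M) → Prop} (h : SF σ P) (e : ∀ v, P v ↔ Q v) :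
    SF σ Q := by
  have : P = Q := funext fun v => propext (e v)
  exact this ▸ h

theorem SF.not {σ : ℕ → ℕ} {P : (ℕ → M) → Prop} (hP : SF σ P) : SF σ (fun v => ¬ P v) :=
  SF.imp hP SF.fls

theorem SF.or {σ : ℕ → ℕ} {P Q : (ℕ → M) → Prop} (hP : SF σ P) (hQ : SF σ Q) :
    SF σ (fun v => P v ∨ Q v) :=
  (SF.imp hP.not hQ).congr fun v => by tauto

theorem SF.and {σ : ℕ → ℕ} {P Q : (ℕ → M) → Prop} (hP : SF σ P) (hQ : SF σ Q) :
    SF σ (fun v => P v ∧ Q v) :=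
  (SF.imp hP hQ.not).not.congr fun v => by tauto

theorem SF.iff {σ : ℕ → ℕ} {P Q : (ℕ → M) → Prop} (hP : SF σ P) (hQ : SF σ Q) :
    SF σ (fun v => P v ↔ Q v) :=
  ((SF.imp hP hQ).and (SF.imp hQ hP)).congr fun v => by tauto

theorem SF.ex {σ : ℕ → ℕ} {k : ℕ} {Q : (ℕ → M) → M → Prop}
    (h : SF (ncons k σ) (fun w => Q (fun i => w (i + 1)) (w 0))) :
    SF σ (fun v => ∃ x, Q v x) :=
  (SF.all (Q := fun v x => ¬ Q v x) h.not).not.congr fun v => by simp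

/-- Environment of a translated formula: parameters, then variables in reverse order. -/
def envVec {A : Type} (m n : ℕ) (c : Fin m → A) (w : ℕ → A) : Fin (m + n) → A :=
  fun i => if h : i.1 < m then c ⟨i.1, h⟩ else w (m + n - 1 - i.1)

theorem snoc_envVec {A : Type} (m n : ℕ) (c : Fin m → A) (w : ℕ → A) (x : A) :
    (Fin.snoc (envVec m n c w) x : Fin (m + n + 1) → A) = envVec m (n + 1) c (ncons x w) := by
  funext i
  refine Fin.lastCases ?_ (fun i => ?_) i
  · simp [envVec, ncons]
  · simp only [Fin.snoc_castSucc, envVec, Fin.val_castSucc]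
    split_ifs with h
    · rfl
    · have hi := i.2
      have : m + (n + 1) - 1 - i.1 = (m + n - 1 - i.1) + 1 := by omega
      rw [this]; rfl

/-- The parameters listed in `L` occur (with their levels) among `c`, `τ`. -/
def Covers (L : List (M × ℕ)) {m : ℕ} (c : Fin m → M) (τ : Fin m → ℕ) : Prop :=
  ∀ p ∈ L, ∃ i, c i = p.1 ∧ τ i = p.2

/-- Level assignment of a translated formula. -/
def envLev (m n : ℕ) (τ : Fin m → ℕ) (σ : ℕ → ℕ) : Empty ⊕ Fin (m + n) → ℕ :=
  Sum.elim (fun e => e.elim) (envVec m n τ σ)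

theorem STm.trans {σ : ℕ → ℕ} {k : ℕ} {s : (ℕ → M) → M} (h : STm σ k s) (n : ℕ) (v0 : ℕ → M) :
    ∃ L : List (M × ℕ), ∀ (m : ℕ) (c : Fin m → M) (τ : Fin m → ℕ), Covers L c τ →
      ∃ t : LNFU.Term (Empty ⊕ Fin (m + n)), termLevel (envLev m n τ σ) t k ∧
        ∀ w : ℕ → M, (∀ i, w (n + i) = v0 i) →
          t.realize (Sum.elim (default : Empty → M) (envVec m n c w)) = s w := by
  induction h with
  | var i =>
    by_cases hi : i < n
    · refine ⟨[], fun m c τ _ => ⟨Term.var (Sum.inr ⟨m + n - 1 - i, by omega⟩), ?_, ?_⟩⟩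
      · simp only [termLevel, envLev, Sum.elim_inr, envVec]
        rw [dif_neg (by omega)]
        congr 1; omega
      · intro w _
        simp only [Term.realize, Sum.elim_inr, envVec]
        rw [dif_neg (by omega)]
        congr 1; omega
    · refine ⟨[(v0 (i - n), σ i)], fun m c τ hc => ?_⟩
      obtain ⟨j, h1, h2⟩ := hc _ (List.mem_singleton.2 rfl)
      refine ⟨Term.var (Sum.inr ⟨j.1, by omega⟩), ?_, ?_⟩
      · simp only [termLevel, envLev, Sum.elim_inr, envVec]
        rw [dif_pos j.2]; exact h2
      · intro w hw
        simp only [Term.realize, Sum.elim_inr, envVec]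
        rw [dif_pos j.2, h1, ← hw]
        simp only
        congr 1; omega
  | const a k =>
    refine ⟨[(a, k)], fun m c τ hc => ?_⟩
    obtain ⟨j, h1, h2⟩ := hc _ (List.mem_singleton.2 rfl)
    refine ⟨Term.var (Sum.inr ⟨j.1, by omega⟩), ?_, ?_⟩
    · simp only [termLevel, envLev, Sum.elim_inr, envVec]
      rw [dif_pos j.2]; exact h2
    · intro w hw
      simp only [Term.realize, Sum.elim_inr, envVec]
      rw [dif_pos j.2, h1]
  | pair _ _ h1 h2 =>
    obtain ⟨L1, h1⟩ := h1
    obtain ⟨L2, h2⟩ := h2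
    refine ⟨L1 ++ L2, fun m c τ hc => ?_⟩
    obtain ⟨t1, l1, r1⟩ := h1 m c τ (fun p hp => hc p (List.mem_append_left _ hp))
    obtain ⟨t2, l2, r2⟩ := h2 m c τ (fun p hp => hc p (List.mem_append_right _ hp))
    refine ⟨Term.func pairF ![t1, t2], ?_, ?_⟩
    · intro i
      fin_cases i
      · exact l1
      · exact l2
    · intro w hw
      simp only [Term.realize, spair]
      congr 1
      funext i
      fin_cases i
      · exact r1 w hw
      · exact r2 w hw

theorem SF.trans {σ : ℕ → ℕ} {P : (ℕ → M) → Prop} (h : SF σ P) : ∀ (n : ℕ) (v0 : ℕ → M),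
    ∃ L : List (M × ℕ), ∀ (m : ℕ) (c : Fin m → M) (τ : Fin m → ℕ), Covers L c τ →
      ∃ φ : LNFU.BoundedFormula Empty (m + n), stratifiedFrom (envLev m n τ σ) φ ∧
        ∀ w : ℕ → M, (∀ i, w (n + i) = v0 i) →
          (φ.Realize (default : Empty → M) (envVec m n c w) ↔ P w) := by
  induction h with
  | fls =>
    intro n v0
    exact ⟨[], fun m c τ _ => ⟨BoundedFormula.falsum, trivial, fun w _ => Iff.rfl⟩⟩
  | eq hs ht =>
    intro n v0
    obtain ⟨L1, h1⟩ := hs.trans n v0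
    obtain ⟨L2, h2⟩ := ht.trans n v0
    refine ⟨L1 ++ L2, fun m c τ hc => ?_⟩
    obtain ⟨t1, l1, r1⟩ := h1 m c τ (fun p hp => hc p (List.mem_append_left _ hp))
    obtain ⟨t2, l2, r2⟩ := h2 m c τ (fun p hp => hc p (List.mem_append_right _ hp))
    refine ⟨BoundedFormula.equal t1 t2, ⟨_, l1, l2⟩, fun w hw => ?_⟩
    simp only [BoundedFormula.Realize]
    rw [r1 w hw, r2 w hw]
  | mem hs ht =>
    intro n v0
    obtain ⟨L1, h1⟩ := hs.trans n v0
    obtain ⟨L2, h2⟩ := ht.trans n v0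
    refine ⟨L1 ++ L2, fun m c τ hc => ?_⟩
    obtain ⟨t1, l1, r1⟩ := h1 m c τ (fun p hp => hc p (List.mem_append_left _ hp))
    obtain ⟨t2, l2, r2⟩ := h2 m c τ (fun p hp => hc p (List.mem_append_right _ hp))
    refine ⟨BoundedFormula.rel memR ![t1, t2], ⟨_, l1, l2⟩, fun w hw => ?_⟩
    simp only [BoundedFormula.Realize, smem]
    rw [← r1 w hw, ← r2 w hw]
    apply iff_of_eq
    congr 1
    funext i
    fin_cases i <;> rfl
  | set hs =>
    intro n v0
    obtain ⟨L1, h1⟩ := hs.trans n v0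
    refine ⟨L1, fun m c τ hc => ?_⟩
    obtain ⟨t1, l1, r1⟩ := h1 m c τ hc
    refine ⟨BoundedFormula.rel setR ![t1], ⟨_, l1⟩, fun w hw => ?_⟩
    simp only [BoundedFormula.Realize, sset]
    rw [← r1 w hw]
    apply iff_of_eq
    congr 1
    funext i
    fin_cases i; rfl
  | imp _ _ h1 h2 =>
    intro n v0
    obtain ⟨L1, h1⟩ := h1 n v0
    obtain ⟨L2, h2⟩ := h2 n v0
    refine ⟨L1 ++ L2, fun m c τ hc => ?_⟩
    obtain ⟨t1, l1, r1⟩ := h1 m c τ (fun p hp => hc p (List.mem_append_left _ hp))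
    obtain ⟨t2, l2, r2⟩ := h2 m c τ (fun p hp => hc p (List.mem_append_right _ hp))
    refine ⟨BoundedFormula.imp t1 t2, ⟨l1, l2⟩, fun w hw => ?_⟩
    simp only [BoundedFormula.Realize]
    rw [r1 w hw, r2 w hw]
  | @all σ k Q _ ih =>
    intro n v0
    obtain ⟨L, hL⟩ := ih (n + 1) v0
    refine ⟨L, fun m c τ hc => ?_⟩
    obtain ⟨φ, l, r⟩ := hL m c τ hc
    refine ⟨BoundedFormula.all φ, ⟨k, ?_⟩, fun w hw => ?_⟩
    · have : Sum.elim (fun e => envLev m n τ σ (Sum.inl e))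
        (Fin.snoc (fun i => envLev m n τ σ (Sum.inr i)) k) = envLev m (n + 1) τ (ncons k σ) := by
        unfold envLev
        congr 1
        exact snoc_envVec m n τ σ k
      rw [this]; exact l
    · simp only [BoundedFormula.Realize]
      apply forall_congr'
      intro x
      rw [snoc_envVec]
      apply r
      intro i
      rw [← hw i]
      have : n + 1 + i = (n + i) + 1 := by omega
      rw [this]; rfl

theorem realize_snoc_liftAt {m : ℕ} (φ : LNFU.BoundedFormula Empty (m + 1)) (c : Fin m → M)
    (y x : M) :
    (φ.liftAt 1 m).Realize (default : Empty → M) (Fin.snoc (Fin.snoc c y) x : Fin (m + 1 + 1) → M)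
      ↔ φ.Realize default (Fin.snoc c x : Fin (m + 1) → M) := by
  rw [BoundedFormula.realize_liftAt_one (by omega)]
  apply iff_of_eq
  congr 1
  funext i
  refine Fin.lastCases ?_ (fun i => ?_) i
  · simp [Fin.snoc]
  · have := i.2
    simp [Fin.snoc]

theorem comp {k : ℕ} (hM : M ⊨ NFUmAC) [Nonempty M] {P : M → Prop}
    (h : SF (fun _ => k) (fun v : ℕ → M => P (v 0))) :
    ∃ y : M, sset y ∧ ∀ x, smem x y ↔ P x := by
  obtain ⟨L, hL⟩ := h.trans 1 (fun _ => Classical.arbitrary M)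
  obtain ⟨φ, hs, hr⟩ := hL L.length (fun i => (L.get i).1) (fun i => (L.get i).2)
    (fun p hp => by
      obtain ⟨i, hi⟩ := List.get_of_mem hp
      exact ⟨i, by simp only [hi], by simp only [hi]⟩)
  have hax : M ⊨ comprehensionAx L.length φ :=
    Theory.realize_sentence_of_mem NFUmAC (Or.inr ⟨_, φ, ⟨_, hs⟩, rfl⟩)
  unfold comprehensionAx at hax
  have hax' := (BoundedFormula.realize_alls (v := (default : Empty → M))).1 hax
    (fun i => (L.get i).1)
  rw [BoundedFormula.realize_ex] at hax'
  obtain ⟨y, hy⟩ := hax'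
  rw [BoundedFormula.realize_inf, BoundedFormula.realize_rel₁] at hy
  refine ⟨y, ?_, fun x => ?_⟩
  · have := hy.1
    simpa [sset, Fin.snoc] using this
  · have h2 := hy.2 x
    rw [BoundedFormula.realize_iff, BoundedFormula.realize_rel₂, realize_snoc_liftAt] at h2
    have h3 := hr (ncons x (fun _ => Classical.arbitrary M)) (fun i => by
      rw [Nat.add_comm]; rfl)
    have h4 : envVec L.length 1 (fun i => (L.get i).1) (ncons x (fun _ => Classical.arbitrary M))
      = (Fin.snoc (fun i => (L.get i).1) x : Fin (L.length + 1) → M) := by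
      rw [← snoc_envVec]; congr 1
      funext i; unfold envVec; exact dif_pos (show i.1 < L.length from i.2)
    rw [h4] at h3
    have h5 := h2.trans h3
    simpa [smem, Fin.snoc, ncons] using h5

end Framework

end NFUweak
namespace NFUweak

set_option linter.unusedSectionVars false
set_option linter.unusedVariables false

section Strat

variable {M : Type} [LNFU.Structure M]

theorem STm.v0 {σ : ℕ → ℕ} {k : ℕ} : STm (ncons k σ) k (fun v : ℕ → M => v 0) :=
  STm.var (σ := ncons k σ) 0

theorem STm.vc {k i : ℕ} : STm (fun _ => k) k (fun v : ℕ → M => v i) :=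
  STm.var (σ := fun _ => k) i

theorem STm.vs {σ : ℕ → ℕ} {k j i : ℕ} (h : STm σ k (fun v : ℕ → M => v i)) :
    STm (ncons j σ) k (fun v : ℕ → M => v (i + 1)) := h.wk

class Def1 (D : M → Prop) (i : outParam ℕ) : Prop where
  out : ∀ {σ : ℕ → ℕ} {k : ℕ} {s : (ℕ → M) → M}, STm σ (k + i) s → SF σ (fun v => D (s v))

class Def2 (D : M → M → Prop) (i j : outParam ℕ) : Prop where
  out : ∀ {σ : ℕ → ℕ} {k : ℕ} {s t : (ℕ → M) → M}, STm σ (k + i) s → STm σ (k + j) t →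
    SF σ (fun v => D (s v) (t v))

class Def3 (D : M → M → M → Prop) (i j l : outParam ℕ) : Prop where
  out : ∀ {σ : ℕ → ℕ} {k : ℕ} {s t u : (ℕ → M) → M}, STm σ (k + i) s → STm σ (k + j) t →
    STm σ (k + l) u → SF σ (fun v => D (s v) (t v) (u v))

class Def4 (D : M → M → M → M → Prop) (i j l m : outParam ℕ) : Prop where
  out : ∀ {σ : ℕ → ℕ} {k : ℕ} {s t u w : (ℕ → M) → M}, STm σ (k + i) s → STm σ (k + j) t →
    STm σ (k + l) u → STm σ (k + m) w → SF σ (fun v => D (s v) (t v) (u v) (w v))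

theorem sf1 {D : M → Prop} {i : ℕ} [h : Def1 D i] {σ : ℕ → ℕ} {k : ℕ} {s : (ℕ → M) → M}
    (hs : STm σ (k + i) s) : SF σ (fun v => D (s v)) := h.out hs

theorem sf2 {D : M → M → Prop} {i j : ℕ} [h : Def2 D i j] {σ : ℕ → ℕ} {k : ℕ}
    {s t : (ℕ → M) → M} (hs : STm σ (k + i) s) (ht : STm σ (k + j) t) :
    SF σ (fun v => D (s v) (t v)) := h.out hs ht

theorem sf3 {D : M → M → M → Prop} {i j l : ℕ} [h : Def3 D i j l] {σ : ℕ → ℕ} {k : ℕ}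
    {s t u : (ℕ → M) → M} (hs : STm σ (k + i) s) (ht : STm σ (k + j) t)
    (hu : STm σ (k + l) u) : SF σ (fun v => D (s v) (t v) (u v)) := h.out hs ht hu

theorem sf4 {D : M → M → M → M → Prop} {i j l m : ℕ} [h : Def4 D i j l m] {σ : ℕ → ℕ} {k : ℕ}
    {s t u w : (ℕ → M) → M} (hs : STm σ (k + i) s) (ht : STm σ (k + j) t)
    (hu : STm σ (k + l) u) (hw : STm σ (k + m) w) :
    SF σ (fun v => D (s v) (t v) (u v) (w v)) := h.out hs ht hu hw

theorem SF.tru {σ : ℕ → ℕ} : SF σ (fun _ : ℕ → M => True) := SF.fls.not.congr (by simp)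

theorem SF.prop {σ : ℕ → ℕ} (p : Prop) : SF σ (fun _ : ℕ → M => p) := by
  by_cases h : p
  · exact SF.tru.congr (by simp [h])
  · exact SF.fls.congr (by simp [h])

theorem SF.ne {σ : ℕ → ℕ} {k : ℕ} {s t : (ℕ → M) → M} (hs : STm σ k s) (ht : STm σ k t) :
    SF σ (fun v => s v ≠ t v) := (SF.eq hs ht).not

/-- Proof of stratification. -/
theorem strat {σ : ℕ → ℕ} {P : (ℕ → M) → Prop} (h : SF σ P := by
  (repeat' first
    | apply STm.v0
    | apply STm.vc
    | apply STm.vs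
    | apply STm.const
    | exact SF.prop _
    | apply STm.pair
    | with_reducible apply SF.and
    | with_reducible apply SF.or
    | with_reducible apply SF.iff
    | with_reducible apply SF.not
    | with_reducible apply SF.ex
    | with_reducible apply SF.eq
    | with_reducible apply SF.ne
    | with_reducible apply SF.mem
    | with_reducible apply SF.set
    | with_reducible apply SF.imp
    | with_reducible apply SF.all
    | with_reducible apply sf1
    | with_reducible apply sf2
    | with_reducible apply sf3
    | with_reducible apply sf4)
  all_goals exact 0) : SF σ P := h

theorem Def1.of {D : M → Prop} {i : ℕ}
    (h : ∀ k, SF (fun _ => k + i) (fun v => D (v 0))) : Def1 D i :=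
  ⟨fun {_ k s} hs => (h k).subst (fun _ => s) (fun _ => hs)⟩

theorem Def2.of {D : M → M → Prop} {i j : ℕ}
    (h : ∀ k, SF (ncons (k + i) (fun _ => k + j)) (fun v => D (v 0) (v 1))) : Def2 D i j :=
  ⟨fun {_ k s t} hs ht => (h k).subst (ncons s (fun _ => t)) (fun i => by
    rcases i with _ | i <;> assumption)⟩

theorem Def3.of {D : M → M → M → Prop} {i j l : ℕ}
    (h : ∀ k, SF (ncons (k + i) (ncons (k + j) (fun _ => k + l)))
      (fun v => D (v 0) (v 1) (v 2))) : Def3 D i j l :=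
  ⟨fun {_ k s t u} hs ht hu => (h k).subst (ncons s (ncons t (fun _ => u))) (fun i => by
    rcases i with _ | _ | i <;> assumption)⟩

theorem Def4.of {D : M → M → M → M → Prop} {i j l m : ℕ}
    (h : ∀ k, SF (ncons (k + i) (ncons (k + j) (ncons (k + l) (fun _ => k + m))))
      (fun v => D (v 0) (v 1) (v 2) (v 3))) : Def4 D i j l m :=
  ⟨fun {_ k s t u w} hs ht hu hw => (h k).subst (ncons s (ncons t (ncons u (fun _ => w))))
    (fun i => by rcases i with _ | _ | _ | i <;> assumption)⟩

instance : Def2 (isSingletonOf (M := M)) 1 0 := Def2.of fun k => by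
  unfold isSingletonOf; exact strat
instance : Def1 (isEmptySet (M := M)) 1 := Def1.of fun k => by
  unfold isEmptySet; exact strat
instance : Def3 (isFunc (M := M)) 1 1 1 := Def3.of fun k => by
  unfold isFunc; exact strat
instance : Def3 (isInjFunc (M := M)) 1 1 1 := Def3.of fun k => by
  unfold isInjFunc; exact strat
instance : Def3 (isBijFunc (M := M)) 1 1 1 := Def3.of fun k => by
  unfold isBijFunc; exact strat
instance : Def2 (equipollent (M := M)) 1 1 := Def2.of fun k => by
  unfold equipollent; exact strat
instance : Def2 (isCardOf (M := M)) 2 1 := Def2.of fun k => by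
  unfold isCardOf; exact strat
instance : Def2 (isIotaImageOf (M := M)) 2 1 := Def2.of fun k => by
  unfold isIotaImageOf; exact strat
instance : Def1 (isZeroCard (M := M)) 2 := Def1.of fun k => by
  unfold isZeroCard; exact strat
instance : Def2 (isSuccOf (M := M)) 2 2 := Def2.of fun k => by
  unfold isSuccOf; exact strat
instance : Def1 (isInductiveSet (M := M)) 3 := Def1.of fun k => by
  unfold isInductiveSet; exact strat
instance : Def1 (isNat (M := M)) 2 := Def1.of fun k => by
  unfold isNat; exact strat
instance : Def1 (isNatSet (M := M)) 3 := Def1.of fun k => by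
  unfold isNatSet; exact strat
instance : Def2 (isPowerSetOf (M := M)) 2 1 := Def2.of fun k => by
  unfold isPowerSetOf; exact strat
instance : Def1 (isRel (M := M)) 1 := Def1.of fun k => by
  unfold isRel; exact strat
instance : Def2 (inField (M := M)) 0 1 := Def2.of fun k => by
  unfold inField; exact strat
instance : Def2 (isFieldSetOf (M := M)) 1 1 := Def2.of fun k => by
  unfold isFieldSetOf; exact strat
instance : Def1 (isBFEXT (M := M)) 1 := Def1.of fun k => by
  unfold isBFEXT; exact strat
instance : Def3 (inSeg (M := M)) 0 1 0 := Def3.of fun k => by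
  unfold inSeg; exact strat
instance : Def3 (isSegOf (M := M)) 1 1 0 := Def3.of fun k => by
  unfold isSegOf; exact strat
instance : Def2 (isTopOf (M := M)) 0 1 := Def2.of fun k => by
  unfold isTopOf; exact strat
instance : Def1 (inOmega (M := M)) 1 := Def1.of fun k => by
  unfold inOmega; exact strat
instance : Def3 (isIsoRel (M := M)) 1 1 1 := Def3.of fun k => by
  unfold isIsoRel; exact strat
instance : Def2 (relIso (M := M)) 1 1 := Def2.of fun k => by
  unfold relIso; exact strat
instance : Def2 (isTypeOf (M := M)) 2 1 := Def2.of fun k => by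
  unfold isTypeOf; exact strat
instance : Def1 (inBF (M := M)) 2 := Def1.of fun k => by
  unfold inBF; exact strat
instance : Def2 (erel (M := M)) 2 2 := Def2.of fun k => by
  unfold erel; exact strat

/-- Models of NFU without choice, as a class. -/
class NFU (M : Type) [LNFU.Structure M] : Prop where
  model : M ⊨ NFUmAC
  ne : Nonempty M

variable [NFU M]

/-- Stratified comprehension. -/
theorem cmp (P : M → Prop) (h : SF (fun _ => 12) (fun v => P (v 0)) := by exact strat) :
    ∃ y, sset y ∧ ∀ x, smem x y ↔ P x :=
  haveI := NFU.ne (M := M)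
  comp NFU.model h

theorem sext {x y : M} (hx : sset x) (hy : sset y) (h : ∀ z, smem z x ↔ smem z y) : x = y := by
  have hax : M ⊨ weakExtAx := (NFU.model (M := M)).realize_of_mem _ (Or.inl (Or.inl rfl))
  have := hax x y
  simp [Fin.snoc, BoundedFormula.realize_rel₁, BoundedFormula.realize_rel₂] at this
  exact (this hx hy).2 h

theorem pair_inj {x y w z : M} (h : spair x y = spair w z) : x = w ∧ y = z := by
  have hax : M ⊨ pairingAx := (NFU.model (M := M)).realize_of_mem _ (Or.inl (Or.inr rfl))
  have := hax x y w z
  simp [Fin.snoc, BoundedFormula.realize_imp] at this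
  exact this h

@[simp] theorem pair_eq {x y w z : M} : spair x y = spair w z ↔ x = w ∧ y = z :=
  ⟨pair_inj, fun h => by rw [h.1, h.2]⟩

/-- A binary relation as a set of pairs. -/
theorem mkRel (P : M → M → Prop)
    (h : SF (fun _ => 12) (fun v => ∃ x y, v 0 = spair x y ∧ P x y) := by exact strat) :
    ∃ R, sset R ∧ (∀ x y, smem (spair x y) R ↔ P x y) ∧
      (∀ p, smem p R → ∃ x y, p = spair x y ∧ P x y) := by
  obtain ⟨R, h1, h2⟩ := cmp (fun p => ∃ x y, p = spair x y ∧ P x y) h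
  refine ⟨R, h1, fun x y => ?_, fun p hp => (h2 p).1 hp⟩
  rw [h2]
  constructor
  · rintro ⟨a, b, e, hp⟩
    obtain ⟨rfl, rfl⟩ := pair_inj e
    exact hp
  · exact fun hp => ⟨x, y, rfl, hp⟩

example (a b : M) : ∃ y, sset y ∧ ∀ x, smem x y ↔ (isNat x ∧ x ≠ a ∧ ∃ z, smem z x ∧ ¬ smem z b) :=
  cmp _

end Strat

end NFUweak
namespace NFUweak

set_option linter.unusedSectionVars false
set_option linter.unusedVariables false

section BFTheory

variable {M : Type} [LNFU.Structure M]

/-- `x R y`. -/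
abbrev rr (R x y : M) : Prop := smem (spair x y) R

def isBisim (Φ R S : M) : Prop := ∀ u w, rr Φ u w →
  (∀ u', rr R u' u → ∃ w', rr S w' w ∧ rr Φ u' w') ∧
  (∀ w', rr S w' w → ∃ u', rr R u' u ∧ rr Φ u' w')

def Sim (R S u w : M) : Prop := ∃ Φ, isBisim Φ R S ∧ rr Φ u w

instance : Def3 (isBisim (M := M)) 1 1 1 := Def3.of fun k => by
  unfold isBisim; exact strat
instance : Def4 (Sim (M := M)) 1 1 0 0 := Def4.of fun k => by
  unfold Sim; exact strat

variable [NFU M]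

theorem Sim.of {R S : M} (P : M → M → Prop)
    (hP : ∀ u w, P u w → (∀ u', rr R u' u → ∃ w', rr S w' w ∧ P u' w') ∧
      (∀ w', rr S w' w → ∃ u', rr R u' u ∧ P u' w')) {u w : M} (h : P u w)
    (hs : SF (fun _ => 12) (fun v => ∃ x y, v 0 = spair x y ∧ P x y) := by exact strat) :
    Sim R S u w := by
  obtain ⟨Φ, _, h2, _⟩ := mkRel P hs
  refine ⟨Φ, ?_, (h2 _ _).2 h⟩
  intro u w
  simp only [rr, h2] at hP ⊢
  exact hP u w

theorem Sim.fwd {R S u w u' : M} (h : Sim R S u w) (hu : rr R u' u) :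
    ∃ w', rr S w' w ∧ Sim R S u' w' := by
  obtain ⟨Φ, h1, h2⟩ := h
  obtain ⟨w', h3, h4⟩ := (h1 u w h2).1 u' hu
  exact ⟨w', h3, Φ, h1, h4⟩

theorem Sim.bwd {R S u w w' : M} (h : Sim R S u w) (hu : rr S w' w) :
    ∃ u', rr R u' u ∧ Sim R S u' w' := by
  obtain ⟨Φ, h1, h2⟩ := h
  obtain ⟨w', h3, h4⟩ := (h1 u w h2).2 w' hu
  exact ⟨w', h3, Φ, h1, h4⟩

theorem Sim.refl (R u : M) : Sim R R u u :=
  Sim.of (fun u w => u = w) (by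
    rintro u w rfl
    exact ⟨fun u' h => ⟨u', h, rfl⟩, fun u' h => ⟨u', h, rfl⟩⟩) rfl

theorem Sim.symm {R S u w : M} (h : Sim R S u w) : Sim S R w u :=
  Sim.of (fun w u => Sim R S u w) (by
    intro w u h
    exact ⟨fun w' h' => h.bwd h', fun u' h' => h.fwd h'⟩) h

theorem Sim.trans {R S T u w z : M} (h : Sim R S u w) (h' : Sim S T w z) : Sim R T u z :=
  Sim.of (fun u z => ∃ w, Sim R S u w ∧ Sim S T w z) (by
    rintro u z ⟨w, h1, h2⟩
    constructor
    · intro u' hu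
      obtain ⟨w', hw, s1⟩ := h1.fwd hu
      obtain ⟨z', hz, s2⟩ := h2.fwd hw
      exact ⟨z', hz, w', s1, s2⟩
    · intro z' hz
      obtain ⟨w', hw, s1⟩ := h2.bwd hz
      obtain ⟨u', hu, s2⟩ := h1.bwd hw
      exact ⟨u', hu, w', s2, s1⟩) ⟨w, h, h'⟩

theorem Sim.mk {R S u w : M} (h1 : ∀ u', rr R u' u → ∃ w', rr S w' w ∧ Sim R S u' w')
    (h2 : ∀ w', rr S w' w → ∃ u', rr R u' u ∧ Sim R S u' w') : Sim R S u w :=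
  Sim.of (fun a b => (a = u ∧ b = w) ∨ Sim R S a b) (by
    rintro a b (⟨rfl, rfl⟩ | h)
    · constructor
      · intro u' hu
        obtain ⟨w', h3, h4⟩ := h1 u' hu
        exact ⟨w', h3, Or.inr h4⟩
      · intro u' hu
        obtain ⟨w', h3, h4⟩ := h2 u' hu
        exact ⟨w', h3, Or.inr h4⟩
    · constructor
      · intro u' hu
        obtain ⟨w', h3, h4⟩ := h.fwd hu
        exact ⟨w', h3, Or.inr h4⟩
      · intro u' hu
        obtain ⟨w', h3, h4⟩ := h.bwd hu
        exact ⟨w', h3, Or.inr h4⟩) (Or.inl ⟨rfl, rfl⟩)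

theorem Sim.minimal {R S u w : M} (h1 : ∀ x, ¬ rr R x u) (h2 : ∀ x, ¬ rr S x w) : Sim R S u w :=
  Sim.mk (fun x hx => (h1 x hx).elim) (fun x hx => (h2 x hx).elim)

theorem fieldL {R x y : M} (h : rr R x y) : inField x R := ⟨y, Or.inl h⟩
theorem fieldR {R x y : M} (h : rr R x y) : inField y R := ⟨x, Or.inr h⟩

theorem wf_ind {R : M} (hR : isBFEXT R) (P : M → Prop)
    (h : ∀ x, inField x R → (∀ y, rr R y x → P y) → P x) {x : M} (hx : inField x R)
    (hP : SF (fun _ => 12) (fun v => P (v 0)) := by exact strat) : P x := by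
  by_contra hc
  obtain ⟨B, hB, hm⟩ := cmp (fun x => inField x R ∧ ¬ P x) (SF.and strat hP.not)
  obtain ⟨b, hb, hmin⟩ := hR.2.1 B hB ⟨x, (hm x).2 ⟨hx, hc⟩⟩ (fun b hb => ((hm b).1 hb).1)
  obtain ⟨h1, h2⟩ := (hm b).1 hb
  refine h2 (h b h1 fun y hy => ?_)
  by_contra hy'
  exact hmin y ((hm y).2 ⟨fieldL hy, hy'⟩) hy

/-! ### Segments -/

theorem inSeg_self (R a : M) : inSeg a R a := fun _ _ _ h _ => h

theorem inSeg_pred {R a x y : M} (h : inSeg y R a) (hx : rr R x y) : inSeg x R a :=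
  fun B h1 h2 h3 h4 => h4 y x (h B h1 h2 h3 h4) hx

theorem inSeg_trans {R a x y : M} (h : inSeg x R y) (h' : inSeg y R a) : inSeg x R a :=
  fun B h1 h2 h3 h4 => h B h1 h2 (h' B h1 h2 h3 h4) h4

theorem inSeg_ind {R a x : M} (ha : inField a R) (hx : inSeg x R a) (P : M → Prop) (h0 : P a)
    (h1 : ∀ b c, inField b R → P b → rr R c b → P c)
    (hP : SF (fun _ => 12) (fun v => P (v 0)) := by exact strat) : P x := by
  obtain ⟨B, hB, hm⟩ := cmp (fun x => inField x R ∧ P x) (SF.and strat hP)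
  refine ((hm x).1 (hx B hB (fun b hb => ((hm b).1 hb).1) ((hm a).2 ⟨ha, h0⟩) ?_)).2
  intro b c hb hc
  exact (hm c).2 ⟨fieldL hc, h1 b c ((hm b).1 hb).1 ((hm b).1 hb).2 hc⟩

theorem inSeg_field {R a x : M} (ha : inField a R) (hx : inSeg x R a) : inField x R :=
  inSeg_ind ha hx (fun x => inField x R) ha (fun _ _ _ _ h => fieldL h)

theorem inSeg_cases {R a x : M} (ha : inField a R) (hx : inSeg x R a) :
    x = a ∨ ∃ c, rr R c a ∧ inSeg x R c :=
  inSeg_ind ha hx (fun x => x = a ∨ ∃ c, rr R c a ∧ inSeg x R c) (Or.inl rfl) (by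
    rintro b c _ (rfl | ⟨d, h1, h2⟩) h
    · exact Or.inr ⟨c, h, inSeg_self _ _⟩
    · exact Or.inr ⟨d, h1, inSeg_pred h2 h⟩)

theorem exists_seg (R a : M) : ∃ s, isSegOf s R a :=
  cmp (fun p => smem p R ∧ ∃ x y, p = spair x y ∧ inSeg x R a ∧ inSeg y R a)

theorem seg_rr {s R a x y : M} (hs : isSegOf s R a) : rr s x y ↔ rr R x y ∧ inSeg y R a := by
  rw [rr, hs.2]
  constructor
  · rintro ⟨h, x', y', e, _, h2⟩
    obtain ⟨rfl, rfl⟩ := pair_inj e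
    exact ⟨h, h2⟩
  · rintro ⟨h, h2⟩
    exact ⟨h, x, y, rfl, inSeg_pred h2 h, h2⟩

theorem seg_isRel {s R a : M} (hs : isSegOf s R a) : isRel s := by
  refine ⟨hs.1, fun p hp => ?_⟩
  obtain ⟨_, x, y, e, _⟩ := (hs.2 p).1 hp
  exact ⟨x, y, e⟩

theorem seg_field {s R a x : M} (hs : isSegOf s R a) (ha : inField a R) :
    inField x s ↔ inSeg x R a ∧ ∃ p, rr R p a := by
  constructor
  · intro h
    have hx : inSeg x R a := by
      obtain ⟨y, h | h⟩ := h
      · exact inSeg_pred ((seg_rr hs).1 h).2 ((seg_rr hs).1 h).1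
      · exact ((seg_rr hs).1 h).2
    refine ⟨hx, ?_⟩
    have : ∃ y z, rr R y z ∧ inSeg z R a := by
      obtain ⟨y, h | h⟩ := h
      · exact ⟨x, y, (seg_rr hs).1 h⟩
      · exact ⟨y, x, (seg_rr hs).1 h⟩
    obtain ⟨y, z, h1, h2⟩ := this
    rcases inSeg_cases ha h2 with rfl | ⟨c, hc, _⟩
    · exact ⟨y, h1⟩
    · exact ⟨c, hc⟩
  · rintro ⟨hx, p, hp⟩
    refine (inSeg_ind ha hx (fun x => inSeg x R a ∧ inField x s)
      ⟨inSeg_self _ _, fieldR ((seg_rr hs).2 ⟨hp, inSeg_self _ _⟩)⟩ ?_).2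
    rintro b c _ ⟨h1, _⟩ h2
    exact ⟨inSeg_pred h1 h2, fieldL ((seg_rr hs).2 ⟨h2, h1⟩)⟩

theorem seg_bfext {s R a : M} (hR : isBFEXT R) (hs : isSegOf s R a) (ha : inField a R) :
    isBFEXT s := by
  refine ⟨seg_isRel hs, ?_, ?_⟩
  · intro B hB hne hf
    obtain ⟨b, hb, hm⟩ := hR.2.1 B hB hne
      (fun b hb => inSeg_field ha ((seg_field hs ha).1 (hf b hb)).1)
    exact ⟨b, hb, fun c hc h => hm c hc ((seg_rr hs).1 h).1⟩
  · intro x y hx hy h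
    have hx' := ((seg_field hs ha).1 hx).1
    have hy' := ((seg_field hs ha).1 hy).1
    refine hR.2.2 x y (inSeg_field ha hx') (inSeg_field ha hy') fun c => ?_
    have := h c
    change rr s c x ↔ rr s c y at this
    rw [seg_rr hs, seg_rr hs] at this
    exact ⟨fun h => (this.1 ⟨h, hx'⟩).1, fun h => (this.2 ⟨h, hy'⟩).1⟩

theorem seg_inSeg {s R a x p : M} (hs : isSegOf s R a) (ha : inField a R) (hp : rr R p a)
    (hx : inSeg x R a) : inSeg x s a := by
  intro B h1 h2 h3 h4
  refine hx B h1 (fun b hb => inSeg_field ha ((seg_field hs ha).1 (h2 b hb)).1) h3 ?_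
  intro b c hb hc
  exact h4 b c hb ((seg_rr hs).2 ⟨hc, ((seg_field hs ha).1 (h2 b hb)).1⟩)

theorem seg_top {s R a p : M} (hs : isSegOf s R a) (ha : inField a R) (hp : rr R p a) :
    isTopOf a s := by
  refine ⟨(seg_field hs ha).2 ⟨inSeg_self _ _, p, hp⟩, hs.1, fun q => ⟨fun hq => ⟨hq, ?_⟩,
    fun h => h.1⟩⟩
  obtain ⟨_, x, y, e, h1, h2⟩ := (hs.2 q).1 hq
  exact ⟨x, y, e, seg_inSeg hs ha hp h1, seg_inSeg hs ha hp h2⟩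

theorem seg_sim {s R a x : M} (hs : isSegOf s R a) (hx : inSeg x R a) : Sim s R x x :=
  Sim.of (fun u w => u = w ∧ inSeg u R a) (by
    rintro u w ⟨rfl, h⟩
    constructor
    · intro u' hu
      have := (seg_rr hs).1 hu
      exact ⟨u', this.1, rfl, inSeg_pred this.2 this.1⟩
    · intro u' hu
      exact ⟨u', (seg_rr hs).2 ⟨hu, h⟩, rfl, inSeg_pred h hu⟩) ⟨rfl, hx⟩

theorem no_cycle {R x c : M} (hR : isBFEXT R) (h1 : rr R c x) (h2 : inSeg x R c) : False := by
  refine wf_ind hR (fun x => ¬ ∃ c, rr R c x ∧ inSeg x R c) ?_ (fieldR h1) strat ⟨c, h1, h2⟩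
  rintro x hx ih ⟨c, h1, h2⟩
  rcases inSeg_cases (fieldL h1) h2 with e | ⟨d, h3, h4⟩
  · exact ih c h1 ⟨c, e ▸ h1, inSeg_self _ _⟩
  · exact ih c h1 ⟨d, h3, inSeg_pred h4 h1⟩

theorem top_inSeg {R r x : M} (h : isTopOf r R) (hx : inField x R) : inSeg x R r := by
  obtain ⟨y, h1 | h1⟩ := hx
  · exact inSeg_pred ((seg_rr h.2).1 h1).2 h1
  · exact ((seg_rr h.2).1 h1).2

theorem top_pred {R r : M} (h : isTopOf r R) : ∃ p, rr R p r :=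
  ((seg_field h.2 h.1).1 h.1).2

theorem top_unique {R r r' : M} (hR : isBFEXT R) (h : isTopOf r R) (h' : isTopOf r' R) :
    r = r' := by
  rcases inSeg_cases h.1 (top_inSeg h h'.1) with e | ⟨c, h1, h2⟩
  · exact e.symm
  · exact (no_cycle hR h1 (inSeg_trans (top_inSeg h' h.1) h2)).elim

theorem top_of {R r : M} (hR : isRel R) (hr : inField r R) (h : ∀ x, inField x R → inSeg x R r) :
    isTopOf r R := by
  refine ⟨hr, hR.1, fun p => ⟨fun hp => ⟨hp, ?_⟩, fun h => h.1⟩⟩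
  obtain ⟨x, y, rfl⟩ := hR.2 p hp
  exact ⟨x, y, rfl, h x (fieldL hp), h y (fieldR hp)⟩

theorem sim_rigid {S y y' : M} (hS : isBFEXT S) (hy : inField y S) (hy' : inField y' S)
    (h : Sim S S y y') : y = y' := by
  refine wf_ind hS (fun y => ∀ y', inField y' S → Sim S S y y' → y = y') ?_ hy strat y' hy' h
  intro y hy ih y' hy' h
  refine hS.2.2 y y' hy hy' fun c => ⟨fun hc => ?_, fun hc => ?_⟩
  · obtain ⟨c', h1, h2⟩ := h.fwd hc
    rw [ih c hc c' (fieldL h1) h2]; exact h1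
  · obtain ⟨c', h1, h2⟩ := h.bwd hc
    rw [← ih c' h1 c (fieldL hc) h2]; exact h1

theorem sim_iso {R S u w sR sS : M} (hR : isBFEXT R) (hS : isBFEXT S) (h : Sim R S u w)
    (hu : inField u R) (hw : inField w S) (hsR : isSegOf sR R u) (hsS : isSegOf sS S w) :
    relIso sR sS := by
  obtain ⟨f, f1, f2, f3⟩ := mkRel (fun x y => inField x sR ∧ inField y sS ∧ Sim R S x y)
  have key : ∀ x y x' y', inField x sR → inField y sR → inField x' sS → inField y' sS →
      Sim R S x x' → Sim R S y y' → rr sR x y → rr sS x' y' := by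
    intro x y x' y' _ _ hx' hy' s1 s2 hxy
    obtain ⟨x'', h1, h2⟩ := s2.fwd ((seg_rr hsR).1 hxy).1
    have hy'' := ((seg_field hsS hw).1 hy').1
    have : x' = x'' := sim_rigid hS (inSeg_field hw ((seg_field hsS hw).1 hx').1) (fieldL h1)
      (s1.symm.trans h2)
    exact (seg_rr hsS).2 ⟨this ▸ h1, hy''⟩
  have key' : ∀ x y x' y', inField x sR → inField y sR → inField x' sS → inField y' sS →
      Sim R S x x' → Sim R S y y' → rr sS x' y' → rr sR x y := by
    intro x y x' y' hx hy _ _ s1 s2 hxy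
    obtain ⟨x'', h1, h2⟩ := s2.bwd ((seg_rr hsS).1 hxy).1
    have hy'' := ((seg_field hsR hu).1 hy).1
    have : x = x'' := sim_rigid hR (inSeg_field hu ((seg_field hsR hu).1 hx).1) (fieldL h1)
      (s1.trans h2.symm)
    exact (seg_rr hsR).2 ⟨this ▸ h1, hy''⟩
  refine ⟨f, f1, ?_, ?_, ?_, ?_, ?_, ?_⟩
  · intro p hp
    obtain ⟨x, y, e, h1, h2, _⟩ := f3 p hp
    exact ⟨x, y, e, h1, h2⟩
  · intro x hx
    obtain ⟨h1, p, hp⟩ := (seg_field hsR hu).1 hx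
    obtain ⟨q, hq, _⟩ := h.fwd hp
    obtain ⟨y, h2, h3⟩ := inSeg_ind hu h1 (fun x => ∃ y, inSeg y S w ∧ Sim R S x y)
      ⟨w, inSeg_self _ _, h⟩ (by
        rintro b c _ ⟨y, h2, h3⟩ h4
        obtain ⟨y', h5, h6⟩ := h3.fwd h4
        exact ⟨y', inSeg_pred h2 h5, h6⟩)
    exact ⟨y, (f2 _ _).2 ⟨hx, (seg_field hsS hw).2 ⟨h2, q, hq⟩, h3⟩⟩
  · intro x y y' h1 h2
    obtain ⟨_, h3, h4⟩ := (f2 _ _).1 h1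
    obtain ⟨_, h5, h6⟩ := (f2 _ _).1 h2
    exact sim_rigid hS (inSeg_field hw ((seg_field hsS hw).1 h3).1)
      (inSeg_field hw ((seg_field hsS hw).1 h5).1) (h4.symm.trans h6)
  · intro x x' y h1 h2
    obtain ⟨h3, _, h4⟩ := (f2 _ _).1 h1
    obtain ⟨h5, _, h6⟩ := (f2 _ _).1 h2
    exact sim_rigid hR (inSeg_field hu ((seg_field hsR hu).1 h3).1)
      (inSeg_field hu ((seg_field hsR hu).1 h5).1) (h4.trans h6.symm)
  · intro x hx
    obtain ⟨h1, p, hp⟩ := (seg_field hsS hw).1 hx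
    obtain ⟨q, hq, _⟩ := h.bwd hp
    obtain ⟨y, h2, h3⟩ := inSeg_ind hw h1 (fun x => ∃ y, inSeg y R u ∧ Sim R S y x)
      ⟨u, inSeg_self _ _, h⟩ (by
        rintro b c _ ⟨y, h2, h3⟩ h4
        obtain ⟨y', h5, h6⟩ := h3.bwd h4
        exact ⟨y', inSeg_pred h2 h5, h6⟩)
    exact ⟨y, (f2 _ _).2 ⟨(seg_field hsR hu).2 ⟨h2, q, hq⟩, hx, h3⟩⟩
  · intro x y x' y' h1 h2
    obtain ⟨h3, h4, h5⟩ := (f2 _ _).1 h1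
    obtain ⟨h6, h7, h8⟩ := (f2 _ _).1 h2
    exact ⟨key x y x' y' h3 h6 h4 h7 h5 h8, key' x y x' y' h3 h6 h4 h7 h5 h8⟩

/-! ### Isomorphisms -/

theorem iso_field {f R S x y : M} (hf : isIsoRel f R S) (h : rr f x y) :
    inField x R ∧ inField y S := by
  obtain ⟨x', y', e, h1, h2⟩ := hf.2.1 _ h
  obtain ⟨rfl, rfl⟩ := pair_inj e
  exact ⟨h1, h2⟩

theorem iso_sim {f R S x y : M} (hf : isIsoRel f R S) (h : rr f x y) : Sim R S x y := by
  refine ⟨f, ?_, h⟩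
  intro u w huw
  constructor
  · intro u' hu
    obtain ⟨w', hw⟩ := hf.2.2.1 u' (fieldL hu)
    exact ⟨w', (hf.2.2.2.2.2.2 _ _ _ _ hw huw).1 hu, hw⟩
  · intro w' hw'
    obtain ⟨u', hu⟩ := hf.2.2.2.2.2.1 w' (fieldL hw')
    exact ⟨u', (hf.2.2.2.2.2.2 _ _ _ _ hu huw).2 hw', hu⟩

theorem relIso_refl (R : M) : relIso R R := by
  obtain ⟨f, f1, f2, f3⟩ := mkRel (fun x y => inField x R ∧ x = y)
  refine ⟨f, f1, ?_, ?_, ?_, ?_, ?_, ?_⟩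
  · intro p hp
    obtain ⟨x, y, e, h1, rfl⟩ := f3 p hp
    exact ⟨x, x, e, h1, h1⟩
  · exact fun x hx => ⟨x, (f2 _ _).2 ⟨hx, rfl⟩⟩
  · intro x y y' h1 h2
    rw [← ((f2 _ _).1 h1).2, ← ((f2 _ _).1 h2).2]
  · intro x y y' h1 h2
    rw [((f2 _ _).1 h1).2, ((f2 _ _).1 h2).2]
  · exact fun x hx => ⟨x, (f2 _ _).2 ⟨hx, rfl⟩⟩
  · intro x y x' y' h1 h2
    rw [((f2 _ _).1 h1).2, ((f2 _ _).1 h2).2]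

theorem relIso_symm {R S : M} (h : relIso R S) : relIso S R := by
  obtain ⟨g, hg⟩ := h
  obtain ⟨f, f1, f2, f3⟩ := mkRel (fun x y => rr g y x)
  refine ⟨f, f1, ?_, ?_, ?_, ?_, ?_, ?_⟩
  · intro p hp
    obtain ⟨x, y, e, h1⟩ := f3 p hp
    exact ⟨x, y, e, (iso_field hg h1).2, (iso_field hg h1).1⟩
  · intro x hx
    obtain ⟨y, hy⟩ := hg.2.2.2.2.2.1 x hx
    exact ⟨y, (f2 _ _).2 hy⟩
  · intro x y y' h1 h2
    exact hg.2.2.2.2.1 _ _ _ ((f2 _ _).1 h1) ((f2 _ _).1 h2)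
  · intro x y y' h1 h2
    exact hg.2.2.2.1 _ _ _ ((f2 _ _).1 h1) ((f2 _ _).1 h2)
  · intro x hx
    obtain ⟨y, hy⟩ := hg.2.2.1 x hx
    exact ⟨y, (f2 _ _).2 hy⟩
  · intro x y x' y' h1 h2
    exact (hg.2.2.2.2.2.2 _ _ _ _ ((f2 _ _).1 h1) ((f2 _ _).1 h2)).symm

theorem relIso_trans {R S T : M} (h : relIso R S) (h' : relIso S T) : relIso R T := by
  obtain ⟨g, hg⟩ := h
  obtain ⟨k, hk⟩ := h'
  obtain ⟨f, f1, f2, f3⟩ := mkRel (fun x y => ∃ z, rr g x z ∧ rr k z y)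
  refine ⟨f, f1, ?_, ?_, ?_, ?_, ?_, ?_⟩
  · intro p hp
    obtain ⟨x, y, e, z, h1, h2⟩ := f3 p hp
    exact ⟨x, y, e, (iso_field hg h1).1, (iso_field hk h2).2⟩
  · intro x hx
    obtain ⟨y, hy⟩ := hg.2.2.1 x hx
    obtain ⟨z, hz⟩ := hk.2.2.1 y (iso_field hg hy).2
    exact ⟨z, (f2 _ _).2 ⟨y, hy, hz⟩⟩
  · intro x y y' h1 h2
    obtain ⟨z, h3, h4⟩ := (f2 _ _).1 h1
    obtain ⟨z', h5, h6⟩ := (f2 _ _).1 h2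
    obtain rfl := hg.2.2.2.1 _ _ _ h3 h5
    exact hk.2.2.2.1 _ _ _ h4 h6
  · intro x y y' h1 h2
    obtain ⟨z, h3, h4⟩ := (f2 _ _).1 h1
    obtain ⟨z', h5, h6⟩ := (f2 _ _).1 h2
    obtain rfl := hk.2.2.2.2.1 _ _ _ h4 h6
    exact hg.2.2.2.2.1 _ _ _ h3 h5
  · intro x hx
    obtain ⟨y, hy⟩ := hk.2.2.2.2.2.1 x hx
    obtain ⟨z, hz⟩ := hg.2.2.2.2.2.1 y (iso_field hk hy).1
    exact ⟨z, (f2 _ _).2 ⟨y, hz, hy⟩⟩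
  · intro x y x' y' h1 h2
    obtain ⟨z, h3, h4⟩ := (f2 _ _).1 h1
    obtain ⟨z', h5, h6⟩ := (f2 _ _).1 h2
    exact (hg.2.2.2.2.2.2 _ _ _ _ h3 h5).trans (hk.2.2.2.2.2.2 _ _ _ _ h4 h6)

theorem iso_bfext {f R S : M} (hR : isBFEXT R) (hS : isRel S) (hf : isIsoRel f R S) :
    isBFEXT S := by
  refine ⟨hS, ?_, ?_⟩
  · rintro B hB ⟨b0, hb0⟩ hfd
    obtain ⟨C, hC, hm⟩ := cmp (fun x => ∃ y, rr f x y ∧ smem y B)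
    obtain ⟨x0, hx0⟩ := hf.2.2.2.2.2.1 b0 (hfd b0 hb0)
    obtain ⟨c, hc, hmin⟩ := hR.2.1 C hC ⟨x0, (hm _).2 ⟨b0, hx0, hb0⟩⟩ (by
      intro b hb
      obtain ⟨y, hy, _⟩ := (hm b).1 hb
      exact (iso_field hf hy).1)
    obtain ⟨y, hy, hyB⟩ := (hm c).1 hc
    refine ⟨y, hyB, fun z hz h => ?_⟩
    obtain ⟨x, hx⟩ := hf.2.2.2.2.2.1 z (hfd z hz)
    exact hmin x ((hm _).2 ⟨z, hx, hz⟩) ((hf.2.2.2.2.2.2 _ _ _ _ hx hy).2 h)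
  · intro a b ha hb h
    obtain ⟨x, hx⟩ := hf.2.2.2.2.2.1 a ha
    obtain ⟨y, hy⟩ := hf.2.2.2.2.2.1 b hb
    have : x = y := by
      refine hR.2.2 x y (iso_field hf hx).1 (iso_field hf hy).1 fun c => ⟨fun hc => ?_, fun hc => ?_⟩
      · obtain ⟨c', hc'⟩ := hf.2.2.1 c (fieldL hc)
        exact (hf.2.2.2.2.2.2 _ _ _ _ hc' hy).2
          ((h c').1 ((hf.2.2.2.2.2.2 _ _ _ _ hc' hx).1 hc))
      · obtain ⟨c', hc'⟩ := hf.2.2.1 c (fieldL hc)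
        exact (hf.2.2.2.2.2.2 _ _ _ _ hc' hx).2
          ((h c').2 ((hf.2.2.2.2.2.2 _ _ _ _ hc' hy).1 hc))
    subst this
    exact hf.2.2.2.1 _ _ _ hx hy

theorem iso_top {f R S r t : M} (hS : isBFEXT S) (hf : isIsoRel f R S)
    (hr : isTopOf r R) (ht : isTopOf t S) : rr f r t := by
  obtain ⟨t', ht'⟩ := hf.2.2.1 r hr.1
  have : isTopOf t' S := by
    refine top_of hS.1 (iso_field hf ht').2 fun y hy => ?_
    obtain ⟨x, hx⟩ := hf.2.2.2.2.2.1 y hy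
    refine inSeg_ind hr.1 (top_inSeg hr (iso_field hf hx).1)
      (fun x => ∀ y, rr f x y → inSeg y S t') ?_ ?_ strat y hx
    · intro y hy
      rw [hf.2.2.2.1 _ _ _ hy ht']; exact inSeg_self _ _
    · intro b c hb ih hc y hy
      obtain ⟨z, hz⟩ := hf.2.2.1 b hb
      exact inSeg_pred (ih z hz) ((hf.2.2.2.2.2.2 _ _ _ _ hy hz).1 hc)
  rwa [top_unique hS ht this]

/-! ### Types -/

def Rep (a R r : M) : Prop := isBFEXT R ∧ isTopOf r R ∧ isTypeOf a R

instance : Def3 (Rep (M := M)) 2 1 0 := Def3.of fun k => by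
  unfold Rep; exact strat

theorem inBF_iff {a : M} : inBF a ↔ ∃ R r, Rep a R r := by
  constructor
  · rintro ⟨R, ⟨h1, r, h2⟩, h3⟩
    exact ⟨R, r, h1, h2, h3⟩
  · rintro ⟨R, r, h1, h2, h3⟩
    exact ⟨R, ⟨h1, r, h2⟩, h3⟩

theorem Rep.mem {a R r : M} (h : Rep a R r) : smem R a := (h.2.2.2 R).2 (relIso_refl R)

theorem exists_type (R : M) : ∃ a, isTypeOf a R := cmp (fun S => relIso S R)

theorem Rep.eq_iff {a R r b S t : M} (h : Rep a R r) (h' : Rep b S t) :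
    a = b ↔ Sim R S r t := by
  constructor
  · rintro rfl
    obtain ⟨f, hf⟩ := (h'.2.2.2 R).1 h.mem
    exact iso_sim hf (iso_top h'.1 hf h.2.1 h'.2.1)
  · intro hs
    have hi := sim_iso h.1 h'.1 hs h.2.1.1 h'.2.1.1 h.2.1.2 h'.2.1.2
    refine sext h.2.2.1 h'.2.2.1 fun X => ?_
    rw [h.2.2.2, h'.2.2.2]
    exact ⟨fun hx => relIso_trans hx hi, fun hx => relIso_trans hx (relIso_symm hi)⟩

theorem Rep.erel_iff {a R r b S t : M} (h : Rep a R r) (h' : Rep b S t) :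
    erel a b ↔ ∃ p, rr S p t ∧ Sim R S r p := by
  constructor
  · rintro ⟨R1, S1, hR1, hS1, x, o, ho, hxo, sg, hsg, hi⟩
    have e1 := (h.2.2.2 R1).1 hR1
    obtain ⟨f, hf⟩ := (h'.2.2.2 S1).1 hS1
    obtain ⟨g, hg⟩ := relIso_trans (relIso_symm e1) hi
    have hot := iso_top h'.1 hf ho h'.2.1
    obtain ⟨p, hp⟩ := hf.2.2.1 x (fieldL hxo)
    have hsgB := iso_bfext h.1 (seg_isRel hsg) hg
    obtain ⟨q, hq⟩ := hg.2.2.1 r h.2.1.1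
    obtain ⟨z, hz⟩ := ((seg_field hsg (fieldL hxo)).1 (iso_field hg hq).2).2
    have htop := seg_top hsg (fieldL hxo) hz
    have := iso_top hsgB hg h.2.1 htop
    exact ⟨p, (hf.2.2.2.2.2.2 _ _ _ _ hp hot).1 hxo,
      ((iso_sim hg this).trans (seg_sim hsg (inSeg_self _ _))).trans (iso_sim hf hp)⟩
  · rintro ⟨p, hp, hs⟩
    obtain ⟨sg, hsg⟩ := exists_seg S p
    exact ⟨R, S, h.mem, h'.mem, p, t, h'.2.1, hp, sg, hsg,
      sim_iso h.1 h'.1 hs h.2.1.1 (fieldL hp) h.2.1.2 hsg⟩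

theorem exists_rep {S p q : M} (hS : isBFEXT S) (hq : rr S q p) :
    ∃ a R r, Rep a R r ∧ Sim R S r p := by
  obtain ⟨s, hs⟩ := exists_seg S p
  obtain ⟨a, ha⟩ := exists_type s
  exact ⟨a, s, p, ⟨seg_bfext hS hs (fieldR hq), seg_top hs (fieldR hq) hq, ha⟩,
    seg_sim hs (inSeg_self _ _)⟩

/-- `a` has the empty object among its predecessors. -/
def hasZero (a : M) : Prop := ∃ R r, Rep a R r ∧ ∃ p, rr R p r ∧ ∀ q, ¬ rr R q p

instance : Def1 (hasZero (M := M)) 2 := Def1.of fun k => by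
  unfold hasZero; exact strat

theorem Rep.hasZero_iff {a R r : M} (h : Rep a R r) :
    hasZero a ↔ ∃ p, rr R p r ∧ ∀ q, ¬ rr R q p := by
  constructor
  · rintro ⟨S, t, hS, p, hp, hm⟩
    obtain ⟨p', hp', hs⟩ := ((hS.eq_iff h).1 rfl).fwd hp
    refine ⟨p', hp', fun q hq => ?_⟩
    obtain ⟨q', hq', _⟩ := hs.bwd hq
    exact hm q' hq'
  · exact fun hp => ⟨R, r, h, hp⟩

theorem bf_ext {a b : M} (ha : inBF a) (hb : inBF b)
    (h : ∀ c, inBF c → (erel c a ↔ erel c b)) (hz : hasZero a ↔ hasZero b) : a = b := by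
  obtain ⟨R, r, hR⟩ := inBF_iff.1 ha
  obtain ⟨S, t, hS⟩ := inBF_iff.1 hb
  rw [hR.eq_iff hS]
  rw [hR.hasZero_iff, hS.hasZero_iff] at hz
  refine Sim.mk (fun u hu => ?_) (fun w hw => ?_)
  · by_cases hm : ∃ q, rr R q u
    · obtain ⟨q, hq⟩ := hm
      obtain ⟨c, T, x, hT, hs⟩ := exists_rep hR.1 hq
      obtain ⟨w, hw, hs'⟩ := (hT.erel_iff hS).1 ((h c (inBF_iff.2 ⟨T, x, hT⟩)).1
        ((hT.erel_iff hR).2 ⟨u, hu, hs⟩))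
      exact ⟨w, hw, hs.symm.trans hs'⟩
    · push Not at hm
      obtain ⟨w, hw, hw'⟩ := hz.1 ⟨u, hu, hm⟩
      exact ⟨w, hw, Sim.minimal hm hw'⟩
  · by_cases hm : ∃ q, rr S q w
    · obtain ⟨q, hq⟩ := hm
      obtain ⟨c, T, x, hT, hs⟩ := exists_rep hS.1 hq
      obtain ⟨u, hu, hs'⟩ := (hT.erel_iff hR).1 ((h c (inBF_iff.2 ⟨T, x, hT⟩)).2
        ((hT.erel_iff hS).2 ⟨w, hw, hs⟩))
      exact ⟨u, hu, hs'.symm.trans hs⟩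
    · push Not at hm
      obtain ⟨u, hu, hu'⟩ := hz.2 ⟨w, hw, hm⟩
      exact ⟨u, hu, Sim.minimal hu' hm⟩

end BFTheory

end NFUweak
namespace NFUweak

set_option linter.unusedSectionVars false
set_option linter.unusedVariables false

section Naturals

variable {M : Type} [LNFU.Structure M] [NFU M]

theorem func_dom {f X Y a b : M} (h : isFunc f X Y) (hab : rr f a b) : smem a X ∧ smem b Y := by
  obtain ⟨a', b', e, h1, h2⟩ := h.2.1 _ hab
  obtain ⟨rfl, rfl⟩ := pair_inj e
  exact ⟨h1, h2⟩

theorem equip_of {X Y : M} (F : M → M → Prop) (h1 : ∀ x y, F x y → smem x X ∧ smem y Y)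
    (h2 : ∀ x, smem x X → ∃ y, F x y) (h3 : ∀ x y y', F x y → F x y' → y = y')
    (h4 : ∀ x x' y, F x y → F x' y → x = x') (h5 : ∀ y, smem y Y → ∃ x, F x y)
    (hF : SF (fun _ => 12) (fun v => ∃ x y, v 0 = spair x y ∧ F x y) := by exact strat) :
    equipollent X Y := by
  obtain ⟨f, f1, f2, f3⟩ := mkRel F hF
  refine ⟨f, ⟨⟨f1, ?_, ?_, ?_⟩, ?_⟩, ?_⟩
  · intro p hp
    obtain ⟨x, y, e, h⟩ := f3 p hp
    exact ⟨x, y, e, h1 x y h⟩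
  · intro x hx
    obtain ⟨y, hy⟩ := h2 x hx
    exact ⟨y, (f2 _ _).2 hy⟩
  · exact fun x y y' a b => h3 x y y' ((f2 _ _).1 a) ((f2 _ _).1 b)
  · exact fun x y y' a b => h4 x y y' ((f2 _ _).1 a) ((f2 _ _).1 b)
  · intro x hx
    obtain ⟨y, hy⟩ := h5 x hx
    exact ⟨y, (f2 _ _).2 hy⟩

theorem equip_refl (X : M) : equipollent X X :=
  equip_of (fun x y => smem x X ∧ x = y) (by rintro x y ⟨h, rfl⟩; exact ⟨h, h⟩)
    (fun x hx => ⟨x, hx, rfl⟩) (fun x y y' h h' => h.2.symm.trans h'.2)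
    (fun x y y' h h' => h.2.trans h'.2.symm) (fun x hx => ⟨x, hx, rfl⟩)

theorem equip_symm {X Y : M} (h : equipollent X Y) : equipollent Y X := by
  obtain ⟨f, ⟨hf, hi⟩, hs⟩ := h
  exact equip_of (fun x y => rr f y x) (fun x y h => (func_dom hf h).symm) hs
    (fun x y y' h h' => hi _ _ _ h h') (fun x y y' h h' => hf.2.2.2 _ _ _ h h') hf.2.2.1

theorem equip_trans {X Y Z : M} (h : equipollent X Y) (h' : equipollent Y Z) :
    equipollent X Z := by
  obtain ⟨f, ⟨hf, hi⟩, hs⟩ := h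
  obtain ⟨g, ⟨hg, hi'⟩, hs'⟩ := h'
  refine equip_of (fun x z => ∃ y, rr f x y ∧ rr g y z) ?_ ?_ ?_ ?_ ?_
  · rintro x z ⟨y, h1, h2⟩
    exact ⟨(func_dom hf h1).1, (func_dom hg h2).2⟩
  · intro x hx
    obtain ⟨y, hy⟩ := hf.2.2.1 x hx
    obtain ⟨z, hz⟩ := hg.2.2.1 y (func_dom hf hy).2
    exact ⟨z, y, hy, hz⟩
  · rintro x z z' ⟨y, h1, h2⟩ ⟨y', h3, h4⟩
    obtain rfl := hf.2.2.2 _ _ _ h1 h3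
    exact hg.2.2.2 _ _ _ h2 h4
  · rintro x x' z ⟨y, h1, h2⟩ ⟨y', h3, h4⟩
    obtain rfl := hi' _ _ _ h2 h4
    exact hi _ _ _ h1 h3
  · intro z hz
    obtain ⟨y, hy⟩ := hs' z hz
    obtain ⟨x, hx⟩ := hs y (func_dom hg hy).1
    exact ⟨x, y, hx, hy⟩

theorem exists_zero : ∃ z : M, isZeroCard z := cmp (fun y => ∀ w, ¬ smem w y)

theorem zero_unique {z z' : M} (h : isZeroCard z) (h' : isZeroCard z') : z = z' :=
  sext h.1 h'.1 fun w => by rw [h.2, h'.2]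

theorem exists_succ (x : M) : ∃ s, isSuccOf s x :=
  cmp (fun y => ∃ z, smem z y ∧ ∃ d, sset d ∧ (∀ w, smem w d ↔ (smem w y ∧ w ≠ z)) ∧ smem d x)

theorem succ_unique {x s s' : M} (h : isSuccOf s x) (h' : isSuccOf s' x) : s = s' :=
  sext h.1 h'.1 fun w => by rw [h.2, h'.2]

theorem zero_nat {z : M} (h : isZeroCard z) : isNat z := fun I hI => hI.2.1 z h

theorem succ_nat {n n' : M} (hn : isNat n) (h : isSuccOf n' n) : isNat n' :=
  fun I hI => hI.2.2 n n' (hn I hI) h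

theorem nat_ind {n : M} (hn : isNat n) (P : M → Prop) (h0 : ∀ z, isZeroCard z → P z)
    (h1 : ∀ n n', isNat n → isSuccOf n' n → P n → P n')
    (hP : SF (fun _ => 12) (fun v => P (v 0)) := by exact strat) : P n := by
  obtain ⟨I, hI, hm⟩ := cmp (fun x => isNat x ∧ P x) (SF.and strat hP)
  refine ((hm n).1 (hn I ⟨hI, fun z hz => (hm z).2 ⟨zero_nat hz, h0 z hz⟩, ?_⟩)).2
  intro a b ha hb
  obtain ⟨h2, h3⟩ := (hm a).1 ha
  exact (hm b).2 ⟨succ_nat h2 hb, h1 a b h2 hb h3⟩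

theorem nat_cases {n : M} (hn : isNat n) : isZeroCard n ∨ ∃ m, isNat m ∧ isSuccOf n m :=
  nat_ind hn (fun n => isZeroCard n ∨ ∃ m, isNat m ∧ isSuccOf n m) (fun z hz => Or.inl hz)
    (fun n n' h h' _ => Or.inr ⟨n, h, h'⟩)

theorem zero_ne_succ {z n : M} (h : isZeroCard z) (h' : isSuccOf z n) : False := by
  obtain ⟨e, _, he'⟩ := cmp (fun _ : M => False)
  obtain ⟨w, hw, _⟩ := (h'.2 e).1 ((h.2 e).2 fun w hw => (he' w).1 hw)
  exact (he' w).1 hw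

/-- natural numbers are equipollence classes -/
theorem nat_class {n D y : M} (hn : isNat n) (hD : smem D n) : smem y n ↔ equipollent y D := by
  refine nat_ind hn (fun n => ∀ D y, smem D n → (smem y n ↔ equipollent y D)) ?_ ?_ strat D y hD
  · intro z hz D y hD
    rw [hz.2] at hD ⊢
    constructor
    · intro hy
      exact equip_of (fun _ _ => False) (by simp) (fun x hx => (hy x hx).elim) (by simp) (by simp)
        (fun x hx => (hD x hx).elim)
    · rintro ⟨f, ⟨hf, _⟩, _⟩ w hw
      obtain ⟨b, hb⟩ := hf.2.2.1 w hw
      exact hD b (func_dom hf hb).2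
  · intro n n' _ hs ih D y hD
    obtain ⟨z, hz, d, hd, hd', hdn⟩ := (hs.2 D).1 hD
    rw [hs.2]
    constructor
    · rintro ⟨z', hz', d2, hd2, hd2', hdn2⟩
      obtain ⟨f, ⟨hf, hi⟩, hsj⟩ := (ih d d2 hdn).1 hdn2
      refine equip_of (fun a b => rr f a b ∨ (a = z' ∧ b = z)) ?_ ?_ ?_ ?_ ?_
      · rintro a b (h | ⟨rfl, rfl⟩)
        · have := func_dom hf h
          exact ⟨((hd2' a).1 this.1).1, ((hd' b).1 this.2).1⟩
        · exact ⟨hz', hz⟩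
      · intro a ha
        by_cases e : a = z'
        · exact ⟨z, Or.inr ⟨e, rfl⟩⟩
        · obtain ⟨b, hb⟩ := hf.2.2.1 a ((hd2' a).2 ⟨ha, e⟩)
          exact ⟨b, Or.inl hb⟩
      · rintro a b b' (h | ⟨rfl, rfl⟩) (h' | ⟨e, rfl⟩)
        · exact hf.2.2.2 _ _ _ h h'
        · exact (((hd2' a).1 (func_dom hf h).1).2 e).elim
        · exact (((hd2' _).1 (func_dom hf h').1).2 rfl).elim
        · rfl
      · rintro a b b' (h | ⟨rfl, rfl⟩) (h' | ⟨rfl, e⟩)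
        · exact hi _ _ _ h h'
        · exact (((hd' _).1 (func_dom hf h).2).2 e).elim
        · exact (((hd' _).1 (func_dom hf h').2).2 rfl).elim
        · rfl
      · intro b hb
        by_cases e : b = z
        · exact ⟨z', Or.inr ⟨rfl, e⟩⟩
        · obtain ⟨a, ha⟩ := hsj b ((hd' b).2 ⟨hb, e⟩)
          exact ⟨a, Or.inl ha⟩
    · rintro ⟨f, ⟨hf, hi⟩, hsj⟩
      obtain ⟨z', hz'⟩ := hsj z hz
      obtain ⟨d2, hd2, hd2'⟩ := cmp (fun w => smem w y ∧ w ≠ z')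
      refine ⟨z', (func_dom hf hz').1, d2, hd2, hd2', (ih d d2 hdn).2 ?_⟩
      refine equip_of (fun a b => rr f a b ∧ a ≠ z') ?_ ?_ ?_ ?_ ?_
      · rintro a b ⟨h, hne⟩
        refine ⟨(hd2' a).2 ⟨(func_dom hf h).1, hne⟩, (hd' b).2 ⟨(func_dom hf h).2, ?_⟩⟩
        rintro rfl
        exact hne (hi _ _ _ h hz')
      · intro a ha
        obtain ⟨h1, h2⟩ := (hd2' a).1 ha
        obtain ⟨b, hb⟩ := hf.2.2.1 a h1
        exact ⟨b, hb, h2⟩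
      · exact fun a b b' h h' => hf.2.2.2 _ _ _ h.1 h'.1
      · exact fun a b b' h h' => hi _ _ _ h.1 h'.1
      · intro b hb
        obtain ⟨h1, h2⟩ := (hd' b).1 hb
        obtain ⟨a, ha⟩ := hsj b h1
        refine ⟨a, ha, ?_⟩
        rintro rfl
        exact h2 (hf.2.2.2 _ _ _ ha hz')

theorem two : ∃ c c' : M, c ≠ c' := by
  obtain ⟨e, _, he⟩ := cmp (fun _ : M => False)
  obtain ⟨u, _, hu⟩ := cmp (fun _ : M => True)
  refine ⟨e, u, ?_⟩
  rintro rfl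
  exact (he e).1 ((hu e).2 trivial)

noncomputable def c0 : M := (two (M := M)).choose
noncomputable def c1 : M := (two (M := M)).choose_spec.choose
theorem c0_ne : (c0 : M) ≠ c1 := (two (M := M)).choose_spec.choose_spec

/-- A Dedekind-infinite system: `w0` and `sh`. -/
noncomputable abbrev w0 : M := spair c1 c1
noncomputable abbrev sh (x : M) : M := spair x c0

theorem sh_ne (x : M) : sh x ≠ w0 := fun h => c0_ne (pair_inj h).2
theorem sh_inj {x y : M} (h : sh x = sh y) : x = y := (pair_inj h).1

theorem nat_nonempty {n : M} (hn : isNat n) : ∃ D, smem D n ∧ sset D ∧ ¬ smem w0 D := by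
  refine nat_ind hn (fun n => ∃ D, smem D n ∧ sset D ∧ ¬ smem w0 D) ?_ ?_
  · intro z hz
    obtain ⟨e, he, he'⟩ := cmp (fun _ : M => False)
    exact ⟨e, (hz.2 e).2 fun w hw => (he' w).1 hw, he, fun h => (he' _).1 h⟩
  · rintro n n' hn hs ⟨D, h1, h2, h3⟩
    obtain ⟨D', h4, h5⟩ := cmp (fun x => smem x D ∨ x = w0)
    obtain ⟨D'', h6, h7⟩ := cmp (fun x => ∃ y, smem y D' ∧ x = sh y)
    have hD' : smem D' n' := by
      refine (hs.2 D').2 ⟨w0, (h5 _).2 (Or.inr rfl), D, h2, fun w => ?_, h1⟩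
      rw [h5]
      constructor
      · intro hw
        refine ⟨Or.inl hw, ?_⟩
        rintro rfl
        exact h3 hw
      · rintro ⟨h | h, h'⟩
        · exact h
        · exact (h' h).elim
    refine ⟨D'', (nat_class (succ_nat hn hs) hD').2 ?_, h6, ?_⟩
    · refine equip_of (fun x y => smem y D' ∧ x = sh y) ?_ ?_ ?_ ?_ ?_
      · rintro x y ⟨h, rfl⟩
        exact ⟨(h7 _).2 ⟨y, h, rfl⟩, h⟩
      · exact fun x hx => (h7 x).1 hx
      · rintro x y y' ⟨_, rfl⟩ ⟨_, h⟩
        exact sh_inj h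
      · rintro x y y' ⟨_, rfl⟩ ⟨_, h⟩
        exact h.symm
      · exact fun y hy => ⟨sh y, hy, rfl⟩
    · intro h
      obtain ⟨y, _, hy⟩ := (h7 _).1 h
      exact sh_ne y hy.symm

theorem succ_inj {n m n' : M} (hn : isNat n) (hm : isNat m) (h : isSuccOf n' n)
    (h' : isSuccOf n' m) (hns : sset n) (hms : sset m) : n = m := by
  obtain ⟨D, h1, h2, h3⟩ := nat_nonempty hn
  obtain ⟨D', h4, h5⟩ := cmp (fun x => smem x D ∨ x = w0)
  have hD' : smem D' n' := by
    refine (h.2 D').2 ⟨w0, (h5 _).2 (Or.inr rfl), D, h2, fun w => ?_, h1⟩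
    rw [h5]
    constructor
    · intro hw
      refine ⟨Or.inl hw, ?_⟩
      rintro rfl
      exact h3 hw
    · rintro ⟨h | h, h'⟩
      · exact h
      · exact (h' h).elim
  obtain ⟨z2, hz2, D2, hD2, hD2', hm2⟩ := (h'.2 D').1 hD'
  have hDm : smem D m := by
    refine (nat_class hm hm2).2 ?_
    refine equip_of (fun x y => smem x D ∧ ((x ≠ z2 ∧ y = x) ∨ (x = z2 ∧ y = w0))) ?_ ?_ ?_ ?_ ?_
    · rintro x y ⟨hx, ⟨h6, rfl⟩ | ⟨rfl, rfl⟩⟩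
      · exact ⟨hx, (hD2' _).2 ⟨(h5 _).2 (Or.inl hx), h6⟩⟩
      · refine ⟨hx, (hD2' _).2 ⟨(h5 _).2 (Or.inr rfl), ?_⟩⟩
        rintro rfl
        exact h3 hx
    · intro x hx
      by_cases e : x = z2
      · exact ⟨w0, hx, Or.inr ⟨e, rfl⟩⟩
      · exact ⟨x, hx, Or.inl ⟨e, rfl⟩⟩
    · rintro x y y' ⟨_, h6⟩ ⟨_, h7⟩
      rcases h6 with ⟨h6, rfl⟩ | ⟨h6, rfl⟩ <;> rcases h7 with ⟨h7, rfl⟩ | ⟨h7, rfl⟩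
      · rfl
      · exact (h6 h7).elim
      · exact (h7 h6).elim
      · rfl
    · rintro x x' y ⟨hx, h6⟩ ⟨hx', h7⟩
      rcases h6 with ⟨h6, rfl⟩ | ⟨h6, rfl⟩ <;> rcases h7 with ⟨h7, e⟩ | ⟨h7, e⟩
      · exact e
      · exact (h3 (e ▸ hx)).elim
      · exact (h3 (e ▸ hx')).elim
      · exact h6.trans h7.symm
    · intro y hy
      obtain ⟨h6, h7⟩ := (hD2' y).1 hy
      rcases (h5 y).1 h6 with h8 | rfl
      · exact ⟨y, h8, Or.inl ⟨h7, rfl⟩⟩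
      · rcases (h5 _).1 hz2 with h9 | h9
        · exact ⟨z2, h9, Or.inr ⟨rfl, rfl⟩⟩
        · exact (h7 h9.symm).elim
  exact sext hns hms fun y => by rw [nat_class hn h1, nat_class hm hDm]

theorem nat_sset {n : M} (hn : isNat n) : sset n := by
  rcases nat_cases hn with h | ⟨m, _, h⟩
  · exact h.1
  · exact h.1

/-! ### Finite sets -/

def isFin (D : M) : Prop := sset D ∧ ∃ n, isNat n ∧ smem D n

instance : Def1 (isFin (M := M)) 1 := Def1.of fun k => by
  unfold isFin; exact strat

theorem fin_of_empty {D : M} (h : sset D) (h' : ∀ w, ¬ smem w D) : isFin D := by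
  obtain ⟨z, hz⟩ := exists_zero (M := M)
  exact ⟨h, z, zero_nat hz, (hz.2 D).2 h'⟩

theorem fin_adjoin {A D z : M} (hA : isFin A) (hD : sset D) (hz : ¬ smem z A)
    (h : ∀ w, smem w D ↔ smem w A ∨ w = z) : isFin D := by
  obtain ⟨h1, n, h2, h3⟩ := hA
  obtain ⟨n', hn'⟩ := exists_succ n
  refine ⟨hD, n', succ_nat h2 hn', (hn'.2 D).2 ⟨z, (h z).2 (Or.inr rfl), A, h1, fun w => ?_, h3⟩⟩
  rw [h]
  constructor
  · intro hw
    refine ⟨Or.inl hw, ?_⟩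
    rintro rfl
    exact hz hw
  · rintro ⟨h | h, h'⟩
    · exact h
    · exact (h' h).elim

theorem fin_ind {D : M} (hD : isFin D) (P : M → Prop)
    (h0 : ∀ D, sset D → (∀ w, ¬ smem w D) → P D)
    (h1 : ∀ A D z, isFin A → sset D → ¬ smem z A → (∀ w, smem w D ↔ smem w A ∨ w = z) →
      P A → P D)
    (hP : SF (fun _ => 11) (fun v => P (v 0)) := by exact strat) : P D := by
  obtain ⟨hDs, n, hn, hDn⟩ := hD
  refine nat_ind hn (fun n => ∀ D, sset D → smem D n → P D) ?_ ?_
    (SF.all (k := 11) (SF.imp strat (SF.imp strat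
      (hP.subst (fun _ v => v 0) (fun _ => STm.v0))))) D hDs hDn
  · intro z hz D hD hDz
    exact h0 D hD ((hz.2 D).1 hDz)
  · intro n n' hn hs ih D hD hDn
    obtain ⟨z, hz, d, hd, hd', hdn⟩ := (hs.2 D).1 hDn
    refine h1 d D z ⟨hd, n, hn, hdn⟩ hD (fun h => ((hd' z).1 h).2 rfl) (fun w => ?_)
      (ih d hd hdn)
    rw [hd']
    constructor
    · intro hw
      by_cases e : w = z
      · exact Or.inr e
      · exact Or.inl ⟨hw, e⟩
    · rintro (h | rfl)
      · exact h.1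
      · exact hz

theorem fin_subset {A D : M} (hD : isFin D) (hA : sset A) (h : ∀ w, smem w A → smem w D) :
    isFin A := by
  refine fin_ind hD (fun D => ∀ A, sset A → (∀ w, smem w A → smem w D) → isFin A) ?_ ?_ strat
    A hA h
  · intro D _ h1 A hA h2
    exact fin_of_empty hA fun w hw => h1 w (h2 w hw)
  · intro D D' z _ _ hz hD' ih A hA hsub
    by_cases hzA : smem z A
    · obtain ⟨A', hA', hm⟩ := cmp (fun w => smem w A ∧ w ≠ z)
      refine fin_adjoin (A := A') (z := z) (ih A' hA' ?_) hA (fun h => ((hm z).1 h).2 rfl) ?_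
      · intro w hw
        obtain ⟨h1, h2⟩ := (hm w).1 hw
        exact ((hD' w).1 (hsub w h1)).resolve_right h2
      · intro w
        rw [hm]
        constructor
        · intro hw
          by_cases e : w = z
          · exact Or.inr e
          · exact Or.inl ⟨hw, e⟩
        · rintro (h | rfl)
          · exact h.1
          · exact hzA
    · refine ih A hA fun w hw => ((hD' w).1 (hsub w hw)).resolve_right ?_
      rintro rfl
      exact hzA hw

theorem fin_card {D : M} (hD : isFin D) : ∃ c, isCardOf c D ∧ isNat c := by
  obtain ⟨_, n, hn, h⟩ := hD
  exact ⟨n, ⟨nat_sset hn, fun y => nat_class hn h⟩, hn⟩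

theorem fin_of_card {D c : M} (hD : sset D) (hc : isCardOf c D) (hn : isNat c) : isFin D :=
  ⟨hD, c, hn, (hc.2 D).2 (equip_refl D)⟩

end Naturals

end NFUweak
namespace NFUweak

set_option linter.unusedSectionVars false
set_option linter.unusedVariables false

section Levels

variable {M : Type} [LNFU.Structure M] [NFU M]

def finBF (a : M) : Prop := ∃ R r D, Rep a R r ∧ isFin D ∧ ∀ x, inField x R → smem x D

theorem m0_iff {y a : M} (hy : isM0Set y) : smem a y ↔ finBF a := by
  rw [hy.2]
  constructor
  · rintro ⟨ha, R, D, c, hR, hD, hc, hn⟩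
    obtain ⟨S, s, hS⟩ := inBF_iff.1 ha
    obtain ⟨f, hf⟩ := (hS.2.2.2 R).1 hR
    obtain ⟨D', h1, h2⟩ := cmp (fun x => inField x S)
    have hDD : equipollent D D' := equip_of (fun x y => rr f x y)
      (fun x y h => ⟨(hD.2 _).2 (iso_field hf h).1, (h2 _).2 (iso_field hf h).2⟩)
      (fun x hx => hf.2.2.1 x ((hD.2 _).1 hx))
      (fun x y y' h h' => hf.2.2.2.1 _ _ _ h h')
      (fun x x' y h h' => hf.2.2.2.2.1 _ _ _ h h')
      (fun y hy => hf.2.2.2.2.2.1 y ((h2 _).1 hy))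
    have hc' : isCardOf c D' :=
      ⟨hc.1, fun y => (hc.2 y).trans ⟨fun h => equip_trans h hDD, fun h => equip_trans h (equip_symm hDD)⟩⟩
    exact ⟨S, s, D', hS, fin_of_card h1 hc' hn, fun x hx => (h2 x).2 hx⟩
  · rintro ⟨R, r, D, hR, hD, h⟩
    obtain ⟨D', h1, h2⟩ := cmp (fun x => inField x R)
    obtain ⟨c, hc, hn⟩ := fin_card (fin_subset hD h1 (fun w hw => h w ((h2 w).1 hw)))
    exact ⟨inBF_iff.2 ⟨R, r, hR⟩, R, D', c, hR.mem, ⟨h1, h2⟩, hc, hn⟩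

theorem finBF_down {a b : M} (ha : finBF a) (hb : inBF b) (h : erel b a) : finBF b := by
  obtain ⟨R, r, D, hR, hD, hRD⟩ := ha
  obtain ⟨S, s, hS⟩ := inBF_iff.1 hb
  obtain ⟨p, hp, hsim⟩ := (hS.erel_iff hR).1 h
  obtain ⟨q, hq⟩ := top_pred hS.2.1
  obtain ⟨q', hq', -⟩ := hsim.fwd hq
  obtain ⟨sg, hsg⟩ := exists_seg R p
  obtain ⟨b', hb'⟩ := exists_type sg
  have hrep : Rep b' sg p := ⟨seg_bfext hR.1 hsg (fieldL hp), seg_top hsg (fieldL hp) hq', hb'⟩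
  have hbb : b = b' := (hS.eq_iff hrep).2 (hsim.trans (seg_sim hsg (inSeg_self R p)).symm)
  subst hbb
  refine ⟨sg, p, D, hrep, hD, fun x hx => hRD x ?_⟩
  exact inSeg_field (fieldL hp) ((seg_field hsg (fieldL hp)).1 hx).1

/-- the levels `M_n` consist of elements of `BF` and are transitive. -/
theorem level_trans {g n m a : M} (hg : isMFun g) (hn : isNat n) (hm : rr g n m) (ha : smem a m) :
    inBF a ∧ ∀ b, inBF b → erel b a → smem b m := by
  have key : ∀ m, rr g n m → ∀ a, smem a m → inBF a ∧ ∀ b, inBF b → erel b a → smem b m := by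
    refine nat_ind hn (fun n => ∀ m, rr g n m → ∀ a, smem a m →
      inBF a ∧ ∀ b, inBF b → erel b a → smem b m) ?_ ?_ strat
    · intro z hz m hm a ha
      have h0 := hg.2.2.2.2.1 z m hz hm
      refine ⟨((h0.2 a).1 ha).1, fun b hb hba => (m0_iff h0).2 ?_⟩
      exact finBF_down ((m0_iff h0).1 ha) hb hba
    · intro n n' hn hn' ih m' hm' a ha
      obtain ⟨m, hm⟩ := hg.2.2.1 n hn
      have h1 := hg.2.2.2.2.2 n n' m m' hn hn' hm hm'
      have ha' := (h1.2 a).1 ha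
      refine ⟨ha'.1, fun b hb hba => (h1.2 b).2 ⟨hb, ?_⟩⟩
      exact (ih m hm b (ha'.2 b hb hba)).2
  exact key m hm a ha

end Levels

end NFUweak
namespace NFUweak

set_option linter.unusedSectionVars false
set_option linter.unusedVariables false

section Coding

variable {M : Type} [LNFU.Structure M] [NFU M]

/-- smallest set containing `p0` and closed under `Rule`. -/
theorem closure_set (p0 : M) (Rule : M → M → Prop)
    (h : SF (fun _ => 12) (fun v => ∃ x y, v 0 = spair x y ∧ Rule x y) := by exact strat) :
    ∃ C, smem p0 C ∧ (∀ p p', smem p C → Rule p p' → smem p' C) ∧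
      (∀ I, smem p0 I → (∀ p p', smem p C → smem p I → Rule p p' → smem p' I) →
        ∀ p, smem p C → smem p I) := by
  obtain ⟨R, -, hR, -⟩ := mkRel Rule h
  obtain ⟨C, -, hC⟩ := cmp (fun p => ∀ I, smem p0 I →
    (∀ p p', smem p I → rr R p p' → smem p' I) → smem p I)
  have h1 : smem p0 C := (hC _).2 fun I h _ => h
  have h2 : ∀ p p', smem p C → Rule p p' → smem p' C := fun p p' hp hr =>
    (hC _).2 fun I hI hI' => hI' p p' ((hC _).1 hp I hI hI') ((hR _ _).2 hr)
  refine ⟨C, h1, h2, fun I hI hI' p hp => ?_⟩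
  obtain ⟨J, -, hJ⟩ := cmp (fun p => smem p C ∧ smem p I)
  refine ((hJ p).1 ((hC p).1 hp J ((hJ _).2 ⟨h1, hI⟩) ?_)).2
  intro q q' hq hqq
  have := (hJ _).1 hq
  exact (hJ _).2 ⟨h2 q q' this.1 ((hR _ _).1 hqq), hI' q q' this.1 this.2 ((hR _ _).1 hqq)⟩

theorem closure_inv {p0 C : M} {Rule : M → M → Prop}
    (h : SF (fun _ => 12) (fun v => ∃ x y, v 0 = spair x y ∧ Rule x y))
    (h1 : smem p0 C)
    (h2 : ∀ p p', smem p C → Rule p p' → smem p' C)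
    (h3 : ∀ I, smem p0 I → (∀ p p', smem p C → smem p I → Rule p p' → smem p' I) →
        ∀ p, smem p C → smem p I) {p : M} (hp : smem p C) :
    p = p0 ∨ ∃ q, smem q C ∧ Rule q p := by
  obtain ⟨R, -, hR, -⟩ := mkRel Rule h
  obtain ⟨J, -, hJ⟩ := cmp (fun p => p = p0 ∨ ∃ q, smem q C ∧ rr R q p)
  have := (hJ p).1 (h3 J ((hJ _).2 (Or.inl rfl))
    (fun p p' hp _ hr => (hJ _).2 (Or.inr ⟨p, hp, (hR _ _).2 hr⟩)) p hp)
  rcases this with h | ⟨q, hq, hr⟩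
  · exact Or.inl h
  · exact Or.inr ⟨q, hq, (hR _ _).1 hr⟩

/-- injection of `3 × ℕ` into `ℕ ∖ {0}`. -/
theorem enum : ∃ E t1 t2 t3 : M, t1 ≠ t2 ∧ t1 ≠ t3 ∧ t2 ≠ t3 ∧
    (∀ m, isNat m → (∃ m', rr E (spair t1 m) m') ∧ (∃ m', rr E (spair t2 m) m') ∧
      ∃ m', rr E (spair t3 m) m') ∧
    (∀ q m', rr E q m' → isNat m' ∧ ¬ isZeroCard m') ∧
    (∀ q q' m', rr E q m' → rr E q' m' → q = q') := by
  obtain ⟨z, hz⟩ := exists_zero (M := M)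
  let t1 : M := w0
  let t2 : M := sh w0
  let t3 : M := sh (sh w0)
  have t12 : t1 ≠ t2 := (sh_ne _).symm
  have t13 : t1 ≠ t3 := (sh_ne _).symm
  have t23 : t2 ≠ t3 := fun h => t12 (sh_inj h)
  clear_value t1 t2 t3
  obtain ⟨St, -, hSt, -⟩ := mkRel (fun q q' : M => ∃ n, (q = spair t1 n ∧ q' = spair t2 n) ∨
    (q = spair t2 n ∧ q' = spair t3 n) ∨ (∃ n', q = spair t3 n ∧ q' = spair t1 n' ∧ isSuccOf n' n))
  have hfun : ∀ q q1 q2, rr St q q1 → rr St q q2 → q1 = q2 := by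
    intro q q1 q2 h1 h2
    obtain ⟨n, h1⟩ := (hSt _ _).1 h1
    obtain ⟨m, h2⟩ := (hSt _ _).1 h2
    rcases h1 with ⟨e1, e2⟩ | ⟨e1, e2⟩ | ⟨n', e1, e2, h1⟩ <;>
    rcases h2 with ⟨e3, e4⟩ | ⟨e3, e4⟩ | ⟨m', e3, e4, h2⟩ <;>
    subst e2 e4 e1 <;> simp_all
    exact succ_unique h1 h2
  have hs : SF (M := M) (fun _ => 12) (fun v => ∃ x y, v 0 = spair x y ∧
    ∃ q m q' m', x = spair q m ∧ y = spair q' m' ∧ rr St q q' ∧ isNat m ∧ isSuccOf m' m) := strat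
  obtain ⟨G, g1, g2, g3⟩ := closure_set (spair (spair t1 z) z) (fun x y => ∃ q m q' m',
    x = spair q m ∧ y = spair q' m' ∧ rr St q q' ∧ isNat m ∧ isSuccOf m' m) hs
  have ginv := fun p hp => closure_inv (p := p) hs g1 g2 g3 hp
  have gnat : ∀ q m, rr G q m → isNat m := by
    obtain ⟨J, -, hJ⟩ := cmp (M := M) (fun p => ∃ q m, p = spair q m ∧ isNat m)
    intro q m h
    have := g3 J ((hJ _).2 ⟨_, _, rfl, zero_nat hz⟩) (by
      rintro p p' - - ⟨q, m, q', m', rfl, rfl, -, hm, hs⟩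
      exact (hJ _).2 ⟨_, _, rfl, succ_nat hm hs⟩) _ h
    obtain ⟨q', m', e, hn⟩ := (hJ _).1 this
    obtain ⟨rfl, rfl⟩ := pair_inj e
    exact hn
  have guniq : ∀ q q' m, rr G q m → rr G q' m → q' = q := by
    obtain ⟨J, -, hJ⟩ := cmp (M := M) (fun p => ∃ q m, p = spair q m ∧ ∀ q', rr G q' m → q' = q)
    intro q q' m h h'
    have := g3 J ?_ ?_ _ h
    · obtain ⟨q1, m1, e, hn⟩ := (hJ _).1 this
      obtain ⟨rfl, rfl⟩ := pair_inj e
      exact hn _ h'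
    · refine (hJ _).2 ⟨_, _, rfl, fun q' hq' => ?_⟩
      rcases ginv _ hq' with e | ⟨q, -, q1, m1, q2, m2, -, e, -, -, hs⟩
      · exact (pair_inj e).1
      · obtain ⟨rfl, rfl⟩ := pair_inj e
        exact (zero_ne_succ hz hs).elim
    · rintro p p' hp hpJ ⟨q, m, q', m', rfl, rfl, hst, hm, hs⟩
      obtain ⟨q0, m0, e, hu⟩ := (hJ _).1 hpJ
      obtain ⟨rfl, rfl⟩ := pair_inj e
      refine (hJ _).2 ⟨_, _, rfl, fun q'' hq'' => ?_⟩
      rcases ginv _ hq'' with e | ⟨p, hpG, q1, m1, q2, m2, rfl, e, hst', hm1, hs'⟩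
      · obtain ⟨rfl, rfl⟩ := pair_inj e
        exact (zero_ne_succ hz hs).elim
      · obtain ⟨rfl, rfl⟩ := pair_inj e
        obtain rfl := succ_inj hm1 hm hs' hs (nat_sset hm1) (nat_sset hm)
        obtain rfl := hu _ hpG
        exact hfun _ _ _ hst' hst
  have next : ∀ q q', (∃ m, rr G q m) → rr St q q' → ∃ m, rr G q' m := by
    rintro q q' ⟨m, hm⟩ h
    obtain ⟨m', hm'⟩ := exists_succ m
    exact ⟨m', g2 _ _ hm ⟨_, _, _, _, rfl, rfl, h, gnat _ _ hm, hm'⟩⟩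
  have s12 : ∀ n, rr St (spair t1 n) (spair t2 n) := fun n => (hSt _ _).2 ⟨n, Or.inl ⟨rfl, rfl⟩⟩
  have s23 : ∀ n, rr St (spair t2 n) (spair t3 n) :=
    fun n => (hSt _ _).2 ⟨n, Or.inr (Or.inl ⟨rfl, rfl⟩)⟩
  have r1 : ∀ n, isNat n → ∃ m, rr G (spair t1 n) m := by
    intro n hn
    refine nat_ind hn (fun n => ∃ m, rr G (spair t1 n) m) ?_ ?_ strat
    · intro z' hz'
      obtain rfl := zero_unique hz hz'
      exact ⟨_, g1⟩
    · intro n n' hn hs ih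
      refine next _ _ (next _ _ (next _ _ ih (s12 n)) (s23 n)) ?_
      exact (hSt _ _).2 ⟨n, Or.inr (Or.inr ⟨n', rfl, rfl, hs⟩)⟩
  have r2 := fun n hn => next _ _ (r1 n hn) (s12 n)
  have r3 := fun n hn => next _ _ (r2 n hn) (s23 n)
  obtain ⟨E, -, hE, -⟩ := mkRel (fun q m' : M => ∃ m, rr G q m ∧ isSuccOf m' m)
  have ex : ∀ q, (∃ m, rr G q m) → ∃ m, rr E q m := by
    rintro q ⟨m, hm⟩
    obtain ⟨m', hm'⟩ := exists_succ m
    exact ⟨m', (hE _ _).2 ⟨m, hm, hm'⟩⟩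
  refine ⟨E, t1, t2, t3, t12, t13, t23, fun m hm => ⟨ex _ (r1 m hm), ex _ (r2 m hm), ex _ (r3 m hm)⟩,
    ?_, ?_⟩
  · intro q m' h
    obtain ⟨m, h1, h2⟩ := (hE _ _).1 h
    exact ⟨succ_nat (gnat _ _ h1) h2, fun h => zero_ne_succ h h2⟩
  · intro q q' m' h h'
    obtain ⟨m, h1, h2⟩ := (hE _ _).1 h
    obtain ⟨n, h3, h4⟩ := (hE _ _).1 h'
    have hm := gnat _ _ h1
    have hn := gnat _ _ h3
    obtain rfl := succ_inj hm hn h2 h4 (nat_sset hm) (nat_sset hn)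
    exact guniq _ _ _ h3 h1

/-- coding of the states of a machine by natural numbers. -/
theorem coding (E Op s0 : M) (hE : ∀ q m', rr E q m' → isNat m' ∧ ¬ isZeroCard m')
    (hE' : ∀ q q' m', rr E q m' → rr E q' m' → q = q')
    (hOp : ∀ q s s', rr Op q s → rr Op q s' → s = s') :
    ∃ Cd, (∀ z, isZeroCard z → ∀ s, rr Cd z s ↔ s = s0) ∧
      (∀ i m m' s s', rr Cd m s → rr E (spair i m) m' → rr Op (spair i s) s' → rr Cd m' s') ∧
      (∀ m s, rr Cd m s → isNat m) ∧ (∀ m s s', rr Cd m s → rr Cd m s' → s = s') := by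
  obtain ⟨z, hz⟩ := exists_zero (M := M)
  have hs : SF (M := M) (fun _ => 12) (fun v => ∃ x y, v 0 = spair x y ∧
    ∃ i m m' s s', x = spair m s ∧ y = spair m' s' ∧ rr E (spair i m) m' ∧ rr Op (spair i s) s') :=
    strat
  obtain ⟨C, c1, c2, c3⟩ := closure_set (spair z s0) (fun x y => ∃ i m m' s s', x = spair m s ∧
    y = spair m' s' ∧ rr E (spair i m) m' ∧ rr Op (spair i s) s') hs
  have cinv := fun p hp => closure_inv (p := p) hs c1 c2 c3 hp
  have cz : ∀ s, rr C z s → s = s0 := by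
    intro s h
    rcases cinv _ h with e | ⟨p, hp, i, m, m', s, s', rfl, e, he, -⟩
    · exact (pair_inj e).2
    · obtain ⟨rfl, rfl⟩ := pair_inj e
      exact ((hE _ _ he).2 hz).elim
  refine ⟨C, ?_, ?_, ?_, ?_⟩
  · intro z' hz' s
    obtain rfl := zero_unique hz hz'
    exact ⟨cz s, fun h => h ▸ c1⟩
  · exact fun i m m' s s' h1 h2 h3 => c2 _ _ h1 ⟨i, m, m', s, s', rfl, rfl, h2, h3⟩
  · intro m s h
    rcases cinv _ h with e | ⟨p, hp, i, m, m', s, s', rfl, e, he, -⟩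
    · obtain ⟨rfl, rfl⟩ := pair_inj e
      exact zero_nat hz
    · obtain ⟨rfl, rfl⟩ := pair_inj e
      exact (hE _ _ he).1
  · obtain ⟨J, -, hJ⟩ := cmp (M := M) (fun p => ∃ m s, p = spair m s ∧ ∀ s', rr C m s' → s = s')
    intro m s s' h h'
    have := c3 J ?_ ?_ _ h
    · obtain ⟨q1, m1, e, hn⟩ := (hJ _).1 this
      obtain ⟨rfl, rfl⟩ := pair_inj e
      exact hn _ h'
    · exact (hJ _).2 ⟨_, _, rfl, fun q' hq' => (cz _ hq').symm⟩
    · rintro p p' hp hpJ ⟨i, m, m', s, s', rfl, rfl, he, ho⟩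
      obtain ⟨q0, m0, e, hu⟩ := (hJ _).1 hpJ
      obtain ⟨rfl, rfl⟩ := pair_inj e
      refine (hJ _).2 ⟨_, _, rfl, fun s'' hs'' => ?_⟩
      rcases cinv _ hs'' with e | ⟨p, hp, i2, m2, m2', s2, s2', rfl, e, he2, ho2⟩
      · obtain ⟨rfl, rfl⟩ := pair_inj e
        exact ((hE _ _ he).2 hz).elim
      · obtain ⟨rfl, rfl⟩ := pair_inj e
        obtain ⟨rfl, rfl⟩ := pair_inj (hE' _ _ _ he he2)
        obtain rfl := hu _ hp
        exact hOp _ _ _ ho ho2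

end Coding

end NFUweak
namespace NFUweak

set_option linter.unusedSectionVars false
set_option linter.unusedVariables false

section Machine

variable {M : Type} [LNFU.Structure M] [NFU M]

theorem exists_sing (x : M) : ∃ s, isSingletonOf s x := by
  obtain ⟨s, h1, h2⟩ := cmp (fun y => y = x)
  exact ⟨s, h1, h2⟩

theorem sing_unique {s s' x : M} (h : isSingletonOf s x) (h' : isSingletonOf s' x) : s = s' :=
  sext h.1 h'.1 fun z => (h.2 z).trans (h'.2 z).symm

theorem sing_inj {s x y : M} (h : isSingletonOf s x) (h' : isSingletonOf s y) : x = y :=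
  (h'.2 x).1 ((h.2 x).2 rfl)

/-- `W`: a copy of the numbers at the bottom level. -/
theorem exists_W : ∃ W : M, smem w0 W ∧ (∀ w, smem w W → smem (sh w) W) ∧
    ∀ I, smem w0 I → (∀ w, smem w I → smem (sh w) I) → ∀ w, smem w W → smem w I := by
  obtain ⟨W, h1, h2, h3⟩ := closure_set (M := M) w0 (fun x y => y = sh x)
  exact ⟨W, h1, fun w hw => h2 w _ hw rfl,
    fun I hI hI' => h3 I hI (by rintro p _ - hp rfl; exact hI' p hp)⟩

theorem fin_inj {W D : M} (h1 : smem w0 W) (h2 : ∀ w, smem w W → smem (sh w) W) (hD : isFin D) :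
    ∃ F, (∀ x, smem x D → ∃ w, rr F x w) ∧ (∀ x w, rr F x w → smem w W) ∧
      (∀ x w w', rr F x w → rr F x w' → w = w') ∧ (∀ x x' w, rr F x w → rr F x' w → x = x') := by
  have key : ∃ F, (∀ x, smem x D ↔ ∃ w, rr F x w) ∧ (∀ x w, rr F x w → smem w W) ∧
      (∀ x w w', rr F x w → rr F x w' → w = w') ∧ (∀ x x' w, rr F x w → rr F x' w → x = x') := by
    refine fin_ind hD (fun D => ∃ F, (∀ x, smem x D ↔ ∃ w, rr F x w) ∧ (∀ x w, rr F x w → smem w W) ∧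
      (∀ x w w', rr F x w → rr F x w' → w = w') ∧ (∀ x x' w, rr F x w → rr F x' w → x = x'))
      ?_ ?_ strat
    · intro D hD hD'
      obtain ⟨F, -, hF⟩ := cmp (M := M) (fun x => False)
      exact ⟨F, fun x => ⟨fun h => (hD' _ h).elim, fun ⟨w, h⟩ => ((hF _).1 h).elim⟩,
        fun x w h => ((hF _).1 h).elim, fun x w w' h => ((hF _).1 h).elim,
        fun x w w' h => ((hF _).1 h).elim⟩
    · rintro A D z hA hD hz hAD ⟨F, f1, f2, f3, f4⟩
      obtain ⟨F', -, hF, -⟩ := mkRel (M := M) (fun x y => (∃ w, rr F x w ∧ y = sh w) ∨ (x = z ∧ y = w0))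
      have nz : ∀ w, ¬ rr F z w := fun w h => hz ((f1 z).2 ⟨w, h⟩)
      refine ⟨F', ?_, ?_, ?_, ?_⟩
      · intro x
        rw [hAD, f1]
        constructor
        · rintro (⟨w, h⟩ | rfl)
          · exact ⟨_, (hF _ _).2 (Or.inl ⟨w, h, rfl⟩)⟩
          · exact ⟨_, (hF _ _).2 (Or.inr ⟨rfl, rfl⟩)⟩
        · rintro ⟨w, h⟩
          rcases (hF _ _).1 h with ⟨w, h, -⟩ | ⟨h, -⟩
          · exact Or.inl ⟨w, h⟩
          · exact Or.inr h
      · intro x w h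
        rcases (hF _ _).1 h with ⟨w, hk, rfl⟩ | ⟨-, rfl⟩
        · exact h2 _ (f2 _ _ hk)
        · exact h1
      · intro x w w' h h'
        rcases (hF _ _).1 h with ⟨w, hk, rfl⟩ | ⟨rfl, rfl⟩ <;>
        rcases (hF _ _).1 h' with ⟨w', hk', rfl⟩ | ⟨e, rfl⟩
        · rw [f3 _ _ _ hk hk']
        · subst e; exact (nz _ hk).elim
        · exact (nz _ hk').elim
        · rfl
      · intro x x' w h h'
        rcases (hF _ _).1 h with ⟨w, hk, rfl⟩ | ⟨rfl, rfl⟩ <;>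
        rcases (hF _ _).1 h' with ⟨w', hk', e⟩ | ⟨e1, e⟩
        · obtain rfl := sh_inj e
          exact f4 _ _ _ hk hk'
        · exact (sh_ne _ e).elim
        · exact (sh_ne _ e.symm).elim
        · exact e1.symm
  obtain ⟨F, f1, f2⟩ := key
  exact ⟨F, fun x hx => (f1 x).1 hx, f2⟩

/-- all finite relations on `W` can be coded by natural numbers. -/
theorem rel_coding (W : M)
    (hW : ∀ I, smem w0 I → (∀ w, smem w I → smem (sh w) I) → ∀ w, smem w W → smem w I) :
    ∃ C : M, (∀ m R, rr C m R → isNat m ∧ sset R) ∧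
      (∀ m R R', rr C m R → rr C m R' → R = R') ∧
      (∀ m R p, isZeroCard m → rr C m R → ¬ smem p R) ∧
      (∃ m R, rr C m R ∧ ∀ p, ¬ smem p R) ∧
      (∀ m R R' w w', rr C m R → sset R' → smem w W → smem w' W →
        (∀ p, smem p R' ↔ smem p R ∨ p = spair w w') → ∃ m', rr C m' R') := by
  obtain ⟨E, t1, t2, t3, t12, t13, t23, e1, e2, e3⟩ := enum (M := M)
  obtain ⟨o, ho⟩ := exists_sing (w0 : M)
  obtain ⟨e, he, he'⟩ := cmp (M := M) (fun x => False)
  obtain ⟨Op, -, hOp, -⟩ := mkRel (M := M) (fun q s' => ∃ i R a b,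
    q = spair i (spair R (spair a b)) ∧
    ((i = t1 ∧ ∃ a' w, isSingletonOf a w ∧ isSingletonOf a' (sh w) ∧
        s' = spair R (spair a' b)) ∨
     (i = t2 ∧ ∃ b' w, isSingletonOf b w ∧ isSingletonOf b' (sh w) ∧
        s' = spair R (spair a b')) ∨
     (i = t3 ∧ ∃ w w' R', isSingletonOf a w ∧ isSingletonOf b w' ∧ sset R' ∧
        (∀ p, smem p R' ↔ smem p R ∨ p = spair w w') ∧ s' = spair R' (spair o o))))
  have fOp : ∀ q s s', rr Op q s → rr Op q s' → s = s' := by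
    intro q s s' h h'
    obtain ⟨i, R, a, b, hq, g⟩ := (hOp _ _).1 h
    subst hq
    obtain ⟨i', R', a', b', eq, g'⟩ := (hOp _ _).1 h'
    obtain ⟨hi, eq'⟩ := pair_inj eq
    obtain ⟨hr, eq''⟩ := pair_inj eq'
    obtain ⟨ha, hb⟩ := pair_inj eq''
    subst hi hr ha hb
    clear eq eq' eq''
    clear h h'
    rcases g with ⟨rfl, a1, w, h1, h2, rfl⟩ | ⟨rfl, a1, w, h1, h2, rfl⟩ |
      ⟨rfl, w, w', R', h1, h2, h3, h4, rfl⟩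
    · rcases g' with ⟨-, a2, w2, h5, h6, rfl⟩ | ⟨h, -⟩ | ⟨h, -⟩
      · obtain rfl := sing_inj h1 h5
        rw [sing_unique h2 h6]
      · exact (t12 h).elim
      · exact (t13 h).elim
    · rcases g' with ⟨h, -⟩ | ⟨-, a2, w2, h5, h6, rfl⟩ | ⟨h, -⟩
      · exact (t12 h.symm).elim
      · obtain rfl := sing_inj h1 h5
        rw [sing_unique h2 h6]
      · exact (t23 h).elim
    · rcases g' with ⟨h, -⟩ | ⟨h, -⟩ | ⟨-, v, v', R2, h5, h6, h7, h8, rfl⟩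
      · exact (t13 h.symm).elim
      · exact (t23 h.symm).elim
      · obtain rfl := sing_inj h1 h5
        obtain rfl := sing_inj h2 h6
        rw [sext h3 h7 fun p => (h4 p).trans (h8 p).symm]
  obtain ⟨Cd, d1, d2, d3, d4⟩ := coding E Op (spair e (spair o o)) e2 e3 fOp
  obtain ⟨C, -, hC, -⟩ := mkRel (M := M) (fun m R => sset R ∧ rr Cd m (spair R (spair o o)))
  refine ⟨C, ?_, ?_, ?_, ?_, ?_⟩
  · intro m R h
    have := (hC _ _).1 h
    exact ⟨d3 _ _ this.2, this.1⟩
  · intro m R R' h h'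
    exact (pair_inj (d4 _ _ _ ((hC _ _).1 h).2 ((hC _ _).1 h').2)).1
  · intro m R p hm h hp
    have := (d1 m hm _).1 ((hC _ _).1 h).2
    obtain ⟨rfl, -⟩ := pair_inj this
    exact (he' _).1 hp
  · obtain ⟨z, hz⟩ := exists_zero (M := M)
    exact ⟨z, e, (hC _ _).2 ⟨he, (d1 z hz _).2 rfl⟩, fun p hp => (he' _).1 hp⟩
  · intro m R R' w w' h hR' hw hw' hRR
    have h0 := ((hC _ _).1 h).2
    have s1 : ∃ m a, isSingletonOf a w ∧ rr Cd m (spair R (spair a o)) := by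
      obtain ⟨I, -, hI⟩ := cmp (M := M)
        (fun w => ∃ m a, isSingletonOf a w ∧ rr Cd m (spair R (spair a o)))
      refine (hI w).1 (hW I ((hI _).2 ⟨m, o, ho, h0⟩) ?_ w hw)
      intro u hu
      obtain ⟨m, a, ha, hc⟩ := (hI u).1 hu
      obtain ⟨a', ha'⟩ := exists_sing (sh u)
      obtain ⟨m', hm'⟩ := (e1 m (d3 _ _ hc)).1
      refine (hI _).2 ⟨m', a', ha', d2 t1 m m' _ _ hc hm' ((hOp _ _).2 ?_)⟩
      exact ⟨t1, R, a, o, rfl, Or.inl ⟨rfl, a', u, ha, ha', rfl⟩⟩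
    obtain ⟨m1, a, ha, h1⟩ := s1
    have s2 : ∃ m b, isSingletonOf b w' ∧ rr Cd m (spair R (spair a b)) := by
      obtain ⟨I, -, hI⟩ := cmp (M := M)
        (fun w' => ∃ m b, isSingletonOf b w' ∧ rr Cd m (spair R (spair a b)))
      refine (hI w').1 (hW I ((hI _).2 ⟨m1, o, ho, h1⟩) ?_ w' hw')
      intro u hu
      obtain ⟨m, b, hb, hc⟩ := (hI u).1 hu
      obtain ⟨b', hb'⟩ := exists_sing (sh u)
      obtain ⟨m', hm'⟩ := (e1 m (d3 _ _ hc)).2.1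
      refine (hI _).2 ⟨m', b', hb', d2 t2 m m' _ _ hc hm' ((hOp _ _).2 ?_)⟩
      exact ⟨t2, R, a, b, rfl, Or.inr (Or.inl ⟨rfl, b', u, hb, hb', rfl⟩)⟩
    obtain ⟨m2, b, hb, h2⟩ := s2
    obtain ⟨m', hm'⟩ := (e1 m2 (d3 _ _ h2)).2.2
    refine ⟨m', (hC _ _).2 ⟨hR', d2 t3 m2 m' _ _ h2 hm' ((hOp _ _).2 ?_)⟩⟩
    exact ⟨t3, R, a, b, rfl, Or.inr (Or.inr ⟨rfl, w, w', R', ha, hb, hR', hRR, rfl⟩)⟩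

/-- the image of a finite relation is coded. -/
theorem image_coded {W C D F R : M}
    (hC0 : ∀ m R, rr C m R → isNat m ∧ sset R)
    (hC1 : ∃ m R, rr C m R ∧ ∀ p, ¬ smem p R)
    (hC2 : ∀ m R R' w w', rr C m R → sset R' → smem w W → smem w' W →
        (∀ p, smem p R' ↔ smem p R ∨ p = spair w w') → ∃ m', rr C m' R')
    (hD : isFin D) (f1 : ∀ x w, rr F x w → smem w W)
    (f2 : ∀ x w w', rr F x w → rr F x w' → w = w') :
    ∃ m T, rr C m T ∧ ∀ p, smem p T ↔ ∃ x y w w', smem x D ∧ smem y D ∧ rr F x w ∧ rr F y w' ∧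
      rr R x y ∧ p = spair w w' := by
  have P1 : ∀ y m S, rr C m S → ∃ m T, rr C m T ∧ ∀ p, smem p T ↔ smem p S ∨
      ∃ x w w', smem x D ∧ rr F x w ∧ rr F y w' ∧ rr R x y ∧ p = spair w w' := by
    intro y m S hS
    refine fin_ind hD (fun A => ∃ m T, rr C m T ∧ ∀ p, smem p T ↔ smem p S ∨
      ∃ x w w', smem x A ∧ rr F x w ∧ rr F y w' ∧ rr R x y ∧ p = spair w w') ?_ ?_ strat
    · intro A hA hA'
      refine ⟨m, S, hS, fun p => ⟨Or.inl, ?_⟩⟩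
      rintro (h | ⟨x, w, w', h, -⟩)
      · exact h
      · exact (hA' _ h).elim
    · rintro A D z hA hD hz hAD ⟨m, T, hT, hT'⟩
      by_cases hc : ∃ w w', rr F z w ∧ rr F y w' ∧ rr R z y
      · obtain ⟨w, w', h1, h2, h3⟩ := hc
        obtain ⟨T', hs, hT2⟩ := cmp (M := M) (fun p => smem p T ∨ p = spair w w')
        obtain ⟨m', hm'⟩ := hC2 m T T' w w' hT hs (f1 _ _ h1) (f1 _ _ h2) hT2
        refine ⟨m', T', hm', fun p => ?_⟩
        rw [hT2, hT']
        constructor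
        · rintro ((h | ⟨x, v, v', h, h'⟩) | rfl)
          · exact Or.inl h
          · exact Or.inr ⟨x, v, v', (hAD x).2 (Or.inl h), h'⟩
          · exact Or.inr ⟨z, w, w', (hAD z).2 (Or.inr rfl), h1, h2, h3, rfl⟩
        · rintro (h | ⟨x, v, v', h, g1, g2, g3, rfl⟩)
          · exact Or.inl (Or.inl h)
          · rcases (hAD x).1 h with h | rfl
            · exact Or.inl (Or.inr ⟨x, v, v', h, g1, g2, g3, rfl⟩)
            · rw [f2 _ _ _ g1 h1, f2 _ _ _ g2 h2]
              exact Or.inr rfl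
      · refine ⟨m, T, hT, fun p => ?_⟩
        rw [hT']
        constructor
        · rintro (h | ⟨x, v, v', h, h'⟩)
          · exact Or.inl h
          · exact Or.inr ⟨x, v, v', (hAD x).2 (Or.inl h), h'⟩
        · rintro (h | ⟨x, v, v', h, g1, g2, g3, rfl⟩)
          · exact Or.inl h
          · rcases (hAD x).1 h with h | rfl
            · exact Or.inr ⟨x, v, v', h, g1, g2, g3, rfl⟩
            · exact (hc ⟨v, v', g1, g2, g3⟩).elim
  have P2 : ∃ m T, rr C m T ∧ ∀ p, smem p T ↔ ∃ x y w w', smem x D ∧ smem y D ∧ rr F x w ∧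
      rr F y w' ∧ rr R x y ∧ p = spair w w' := by
    refine fin_ind hD (fun B => ∃ m T, rr C m T ∧ ∀ p, smem p T ↔ ∃ x y w w', smem x D ∧
      smem y B ∧ rr F x w ∧ rr F y w' ∧ rr R x y ∧ p = spair w w') ?_ ?_ strat
    · intro A hA hA'
      obtain ⟨m, S, hS, hS'⟩ := hC1
      refine ⟨m, S, hS, fun p => ⟨fun h => (hS' p h).elim, ?_⟩⟩
      rintro ⟨x, y, w, w', -, h, -⟩
      exact (hA' _ h).elim
    · rintro A B z hA hB hz hAB ⟨m, S, hS, hS'⟩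
      obtain ⟨m', T, hT, hT'⟩ := P1 z m S hS
      refine ⟨m', T, hT, fun p => ?_⟩
      rw [hT', hS']
      constructor
      · rintro (⟨x, y, w, w', h1, h2, h⟩ | ⟨x, w, w', h1, h⟩)
        · exact ⟨x, y, w, w', h1, (hAB _).2 (Or.inl h2), h⟩
        · exact ⟨x, z, w, w', h1, (hAB _).2 (Or.inr rfl), h⟩
      · rintro ⟨x, y, w, w', h1, h2, h⟩
        rcases (hAB y).1 h2 with h2 | rfl
        · exact Or.inl ⟨x, y, w, w', h1, h2, h⟩
        · exact Or.inr ⟨x, w, w', h1, h⟩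
  exact P2

/-- `h` sends `a` to the singleton of `x`. -/
def hs (h a x : M) : Prop := ∃ s, isSingletonOf s x ∧ rr h a s
instance : Def3 (hs (M := M)) 2 1 0 := Def3.of fun k => by
  unfold hs; exact strat

theorem base_inj {m0 N z : M} (hm : isM0Set m0) (hN : isNatSet N) (hz : isZeroCard z) :
    ∃ h, (∀ a, smem a m0 → ∃ x, hs h a x) ∧
      (∀ a x, hs h a x → smem a m0 ∧ smem x N ∧ x ≠ z) ∧
      (∀ a a' x, hs h a x → hs h a' x → a = a') := by
  obtain ⟨W, w1, w2, w3⟩ := exists_W (M := M)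
  obtain ⟨C, c1, c2, c3, c4, c5⟩ := rel_coding W w3
  obtain ⟨h, -, hh, -⟩ := mkRel (M := M) (fun a s => smem a m0 ∧ ∃ m R, isSingletonOf s m ∧ rr C m R ∧
    smem R a)
  have hiff : ∀ a x, hs h a x ↔ smem a m0 ∧ ∃ R, rr C x R ∧ smem R a := by
    intro a x
    constructor
    · rintro ⟨s, hs, h⟩
      obtain ⟨h1, m, R, h2, h3⟩ := (hh _ _).1 h
      obtain rfl := sing_inj hs h2
      exact ⟨h1, R, h3⟩
    · rintro ⟨h1, R, h2⟩
      obtain ⟨s, hs⟩ := exists_sing x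
      exact ⟨s, hs, (hh _ _).2 ⟨h1, x, R, hs, h2⟩⟩
  refine ⟨h, ?_, ?_, ?_⟩
  · intro a ha
    obtain ⟨R, r, D, hR, hD, hRD⟩ := (m0_iff hm).1 ha
    obtain ⟨F, f1, f2, f3, f4⟩ := fin_inj w1 w2 hD
    obtain ⟨m, T, hT, hT'⟩ := image_coded (R := R) c1 c4 c5 hD f2 f3
    refine ⟨m, (hiff _ _).2 ⟨ha, T, hT, (hR.2.2.2 T).2 ?_⟩⟩
    apply relIso_symm
    obtain ⟨i, i1, i2, i3⟩ := mkRel (M := M) (fun x w => inField x R ∧ rr F x w)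
    have hTr : ∀ x y w w', rr F x w → rr F y w' → (rr R x y ↔ rr T w w') := by
      intro x y w w' h1 h2
      constructor
      · intro h
        exact (hT' _).2 ⟨x, y, w, w', hRD _ (fieldL h), hRD _ (fieldR h), h1, h2, h, rfl⟩
      · intro h
        obtain ⟨x', y', v, v', -, -, h3, h4, h5, e⟩ := (hT' _).1 h
        obtain ⟨rfl, rfl⟩ := pair_inj e
        rwa [f4 _ _ _ h1 h3, f4 _ _ _ h2 h4]
    have hfield : ∀ x w, inField x R → rr F x w → inField w T := by
      rintro x w ⟨y, h | h⟩ hxw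
      · obtain ⟨v, hv⟩ := f1 y (hRD _ (fieldR h))
        exact fieldL ((hTr _ _ _ _ hxw hv).1 h)
      · obtain ⟨v, hv⟩ := f1 y (hRD _ (fieldL h))
        exact fieldR ((hTr _ _ _ _ hv hxw).1 h)
    refine ⟨i, i1, ?_, ?_, ?_, ?_, ?_, ?_⟩
    · intro p hp
      obtain ⟨x, y, e, h1, h2⟩ := i3 p hp
      exact ⟨x, y, e, h1, hfield _ _ h1 h2⟩
    · intro x hx
      obtain ⟨w, hw⟩ := f1 x (hRD x hx)
      exact ⟨w, (i2 _ _).2 ⟨hx, hw⟩⟩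
    · exact fun x y y' h h' => f3 _ _ _ ((i2 _ _).1 h).2 ((i2 _ _).1 h').2
    · exact fun x y y' h h' => f4 _ _ _ ((i2 _ _).1 h).2 ((i2 _ _).1 h').2
    · rintro w ⟨w', h | h⟩
      · obtain ⟨x', y', v, v', -, -, h3, h4, h5, e⟩ := (hT' _).1 h
        obtain ⟨rfl, rfl⟩ := pair_inj e
        exact ⟨x', (i2 _ _).2 ⟨fieldL h5, h3⟩⟩
      · obtain ⟨x', y', v, v', -, -, h3, h4, h5, e⟩ := (hT' _).1 h
        obtain ⟨rfl, rfl⟩ := pair_inj e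
        exact ⟨y', (i2 _ _).2 ⟨fieldR h5, h4⟩⟩
    · exact fun x y x' y' h h' => hTr _ _ _ _ ((i2 _ _).1 h).2 ((i2 _ _).1 h').2
  · intro a x hx
    obtain ⟨ha, R, h1, h2⟩ := (hiff _ _).1 hx
    refine ⟨ha, (hN.2 x).2 (c1 _ _ h1).1, ?_⟩
    rintro rfl
    obtain ⟨S, s, D, hS, -⟩ := (m0_iff hm).1 ha
    obtain ⟨f, hf⟩ := (hS.2.2.2 R).1 h2
    obtain ⟨p, hp⟩ := top_pred hS.2.1
    obtain ⟨x', hx'⟩ := hf.2.2.2.2.2.1 p (fieldL hp)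
    obtain ⟨y, h | h⟩ := (iso_field hf hx').1
    · exact c3 _ _ _ hz h1 h
    · exact c3 _ _ _ hz h1 h
  · intro a a' x h h'
    obtain ⟨ha, R, h1, h2⟩ := (hiff _ _).1 h
    obtain ⟨ha', R', h1', h2'⟩ := (hiff _ _).1 h'
    obtain rfl := c2 _ _ _ h1 h1'
    obtain ⟨S, s, D, hS, -⟩ := (m0_iff hm).1 ha
    obtain ⟨S', s', D', hS', -⟩ := (m0_iff hm).1 ha'
    refine sext hS.2.2.1 hS'.2.2.1 fun Z => ?_
    have e : relIso S S' := relIso_trans (relIso_symm ((hS.2.2.2 R).1 h2)) ((hS'.2.2.2 R).1 h2')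
    rw [hS.2.2.2, hS'.2.2.2]
    exact ⟨fun h => relIso_trans h e, fun h => relIso_trans h (relIso_symm e)⟩

end Machine

end NFUweak
namespace NFUweak

set_option linter.unusedSectionVars false
set_option linter.unusedVariables false

section Invariant

variable {M : Type} [LNFU.Structure M] [NFU M]

/-- `h` is an injection of `m` into `ι``X` avoiding `{z}`. -/
def goodInj (m X h z : M) : Prop :=
  smem z X ∧ (∀ a, smem a m → ∃ x, hs h a x) ∧
      (∀ a x, hs h a x → smem a m ∧ smem x X ∧ x ≠ z) ∧
      (∀ a a' x, hs h a x → hs h a' x → a = a')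
instance : Def4 (goodInj (M := M)) 3 2 3 1 := Def4.of fun k => by
  unfold goodInj; exact strat

theorem step_inj {m m' X0 h z X Y P : M} (hg : goodInj m X0 h z)
    (hm' : ∀ a, smem a m' ↔ (inBF a ∧ ∀ b, inBF b → erel b a → smem b m))
    (hY : isIotaImageOf Y X) (hP : isPowerSetOf P X) (heq : equipollent X0 Y) :
    ∃ h' z', goodInj m' P h' z' := by
  obtain ⟨g0, g1, g2, g3⟩ := hg
  obtain ⟨e, ⟨he, hei⟩, hes⟩ := heq
  obtain ⟨h', -, hh, -⟩ := mkRel (M := M) (fun c s => smem c m' ∧ ∃ W, isSingletonOf s W ∧ sset W ∧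
    ∀ u, smem u W ↔ ((∃ a x s, smem a m ∧ erel a c ∧ hs h a x ∧ isSingletonOf s u ∧ rr e x s) ∨
      (hasZero c ∧ ∃ s, isSingletonOf s u ∧ rr e z s)))
  have hiff : ∀ c W, hs h' c W ↔ smem c m' ∧ sset W ∧
      ∀ u, smem u W ↔ ((∃ a x s, smem a m ∧ erel a c ∧ hs h a x ∧ isSingletonOf s u ∧ rr e x s) ∨
      (hasZero c ∧ ∃ s, isSingletonOf s u ∧ rr e z s)) := by
    intro c W
    constructor
    · rintro ⟨s, hs, hk⟩
      obtain ⟨h1, W', h2, h3⟩ := (hh _ _).1 hk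
      obtain rfl := sing_inj hs h2
      exact ⟨h1, h3⟩
    · rintro ⟨h1, h2⟩
      obtain ⟨s, hs⟩ := exists_sing W
      exact ⟨s, hs, (hh _ _).2 ⟨h1, W, hs, h2⟩⟩
  have img : ∀ x, smem x X0 → ∃ s u, isSingletonOf s u ∧ smem u X ∧ rr e x s := by
    intro x hx
    obtain ⟨s, hs⟩ := he.2.2.1 x hx
    obtain ⟨u, hu, hsu⟩ := (hY.2 s).1 (func_dom he hs).2
    exact ⟨s, u, hsu, hu, hs⟩
  have inX : ∀ x s u, rr e x s → isSingletonOf s u → smem u X := by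
    intro x s u h1 h2
    obtain ⟨u', hu, hsu⟩ := (hY.2 s).1 (func_dom he h1).2
    rwa [sing_inj h2 hsu]
  have same : ∀ x x' s s' u, rr e x s → rr e x' s' → isSingletonOf s u → isSingletonOf s' u → x = x' := by
    intro x x' s s' u h1 h2 h3 h4
    obtain rfl := sing_unique h3 h4
    exact hei _ _ _ h1 h2
  obtain ⟨z', hz, hz'⟩ := cmp (M := M) (fun x => False)
  refine ⟨h', z', (hP.2 z').2 ⟨hz, fun w hw => ((hz' _).1 hw).elim⟩, ?_, ?_, ?_⟩
  · intro c hc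
    obtain ⟨W, hW, hW'⟩ := cmp (M := M) (fun u =>
      (∃ a x s, smem a m ∧ erel a c ∧ hs h a x ∧ isSingletonOf s u ∧ rr e x s) ∨
      (hasZero c ∧ ∃ s, isSingletonOf s u ∧ rr e z s))
    exact ⟨W, (hiff _ _).2 ⟨hc, hW, hW'⟩⟩
  · intro c W hc
    obtain ⟨hc, hW, hW'⟩ := (hiff _ _).1 hc
    refine ⟨hc, (hP.2 W).2 ⟨hW, ?_⟩, ?_⟩
    · intro u hu
      rcases (hW' u).1 hu with ⟨a, x, s, -, -, -, h1, h2⟩ | ⟨-, s, h1, h2⟩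
      · exact inX _ _ _ h2 h1
      · exact inX _ _ _ h2 h1
    · rintro rfl
      obtain ⟨hcb, hcm⟩ := (hm' c).1 hc
      obtain ⟨R, r, hR⟩ := inBF_iff.1 hcb
      obtain ⟨p, hp⟩ := top_pred hR.2.1
      by_cases hq : ∃ q, rr R q p
      · obtain ⟨q, hq⟩ := hq
        obtain ⟨a, S, s, hS, hsim⟩ := exists_rep hR.1 hq
        have hac : erel a c := (hS.erel_iff hR).2 ⟨p, hp, hsim⟩
        have ham := hcm a (inBF_iff.2 ⟨S, s, hS⟩) hac
        obtain ⟨x, hx⟩ := g1 a ham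
        obtain ⟨s, u, h1, h2, h3⟩ := img x (g2 a x hx).2.1
        exact (hz' _).1 ((hW' u).2 (Or.inl ⟨a, x, s, ham, hac, hx, h1, h3⟩))
      · have : hasZero c := hR.hasZero_iff.2 ⟨p, hp, fun q h => hq ⟨q, h⟩⟩
        obtain ⟨s, u, h1, h2, h3⟩ := img z g0
        exact (hz' _).1 ((hW' u).2 (Or.inr ⟨this, s, h1, h3⟩))
  · have half : ∀ c c' W, hs h' c W → hs h' c' W →
        (∀ a, inBF a → erel a c → erel a c') ∧ (hasZero c → hasZero c') := by
      intro c c' W hc hc'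
      obtain ⟨hc, -, hW⟩ := (hiff _ _).1 hc
      obtain ⟨hc', -, hW'⟩ := (hiff _ _).1 hc'
      constructor
      · intro a ha hac
        have ham := ((hm' c).1 hc).2 a ha hac
        obtain ⟨x, hx⟩ := g1 a ham
        obtain ⟨s, u, h1, h2, h3⟩ := img x (g2 a x hx).2.1
        rcases (hW' u).1 ((hW u).2 (Or.inl ⟨a, x, s, ham, hac, hx, h1, h3⟩)) with
          ⟨a', x', s', k1, k2, k3, k4, k5⟩ | ⟨k0, s', k1, k2⟩
        · obtain rfl := same _ _ _ _ _ h3 k5 h1 k4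
          obtain rfl := g3 _ _ _ hx k3
          exact k2
        · exact ((g2 a x hx).2.2 (same _ _ _ _ _ h3 k2 h1 k1)).elim
      · intro h0
        obtain ⟨s, u, h1, h2, h3⟩ := img z g0
        rcases (hW' u).1 ((hW u).2 (Or.inr ⟨h0, s, h1, h3⟩)) with
          ⟨a', x', s', k1, k2, k3, k4, k5⟩ | ⟨k0, s', k1, k2⟩
        · exact ((g2 a' x' k3).2.2 (same _ _ _ _ _ h3 k5 h1 k4).symm).elim
        · exact k0
    intro c c' W hc hc'
    have k1 := half _ _ _ hc hc'
    have k2 := half _ _ _ hc' hc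
    refine bf_ext ((hm' c).1 ((hiff _ _).1 hc).1).1 ((hm' c').1 ((hiff _ _).1 hc').1).1 ?_
      ⟨k1.2, k2.2⟩
    exact fun a ha => ⟨k1.1 a ha, k2.1 a ha⟩

theorem invariant {f g n b m : M} (hf : isBethFun f) (hg : isMFun g) (hn : isNat n)
    (hb : rr f n b) (hm : rr g n m) (hne : ¬ isEmptySet b) :
    ∃ X h z, isCardOf b X ∧ goodInj m X h z := by
  have key : ∀ b m, rr f n b → rr g n m → ¬ isEmptySet b →
      ∃ X h z, isCardOf b X ∧ goodInj m X h z := by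
    refine nat_ind hn (fun n => ∀ b m, rr f n b → rr g n m → ¬ isEmptySet b →
      ∃ X h z, isCardOf b X ∧ goodInj m X h z) ?_ ?_ strat
    · intro z hz b m hb hm hne
      obtain ⟨N, hN, hc⟩ := hf.2.2.2.2.1 z b hz hb
      obtain ⟨h, h1, h2⟩ := base_inj (hg.2.2.2.2.1 z m hz hm) hN hz
      exact ⟨N, h, z, hc, (hN.2 z).2 (zero_nat hz), h1, h2⟩
    · intro n n' hn hs ih b' m' hb' hm' hne
      obtain ⟨b, hb⟩ := hf.2.2.1 n hn
      obtain ⟨m, hm⟩ := hg.2.2.1 n hn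
      rcases hf.2.2.2.2.2 n n' b b' hn hs hb hb' with h | ⟨h1, h | h⟩
      · exact (hne h.2).elim
      · obtain ⟨X, Y, P, hY, hbY, hP, hbP⟩ := h
        obtain ⟨X0, h, z, hc, hgood⟩ := ih b m hb hm h1
        have heq : equipollent X0 Y := (hbY.2 X0).1 ((hc.2 X0).2 (equip_refl X0))
        obtain ⟨h', z', hg'⟩ := step_inj hgood (hg.2.2.2.2.2 n n' m m' hn hs hm hm').2 hY hP heq
        exact ⟨P, h', z', hbP, hg'⟩
      · exact (hne h.1).elim
  exact key b m hb hm hne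

end Invariant

end NFUweak
namespace NFUweak

set_option linter.unusedSectionVars false
set_option linter.unusedVariables false

section Final

variable {M : Type} [LNFU.Structure M] [NFU M]

/-- `k` sends `a` to the double singleton of `p`. -/
def hs2 (k a p : M) : Prop := ∃ s t, isSingletonOf s p ∧ isSingletonOf t s ∧ rr k a t
instance : Def3 (hs2 (M := M)) 3 2 0 := Def3.of fun k => by
  unfold hs2; exact strat

theorem exists_points {m X h z b t4 c : M} (hg : goodInj m X h z) (hb : isCardOf b X)
    (ht : isT4Of t4 c) (hle : cardLe b t4) :
    ∃ k, (∀ a, smem a m → ∃ p, hs2 k a p) ∧ (∀ a p, hs2 k a p → smem a m ∧ ∃ y, p = spair y c0) ∧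
      (∀ a p p', hs2 k a p → hs2 k a p' → p = p') ∧ (∀ a a' p, hs2 k a p → hs2 k a' p → a = a') := by
  obtain ⟨g0, g1, g2, g3⟩ := hg
  obtain ⟨t1, t2, t3, -, -, ⟨X2, Y2, -, hY2, ht3⟩, ⟨X3, Y3, hX3, hY3, ht4⟩⟩ := ht
  obtain ⟨X', Y', i, hX', hY', hi⟩ := hle
  obtain ⟨e1, ⟨he1, he1i⟩, -⟩ := equip_symm ((hb.2 X').1 hX')
  obtain ⟨e2, ⟨he2, he2i⟩, -⟩ := (ht4.2 Y').1 hY'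
  obtain ⟨e3, ⟨he3, he3i⟩, -⟩ := (ht3.2 X3).1 hX3
  obtain ⟨j, -, hj, -⟩ := mkRel (M := M) (fun x s => ∃ x' y' y x3 y2 u s', rr e1 x x' ∧ rr i x' y' ∧
    rr e2 y' y ∧ isSingletonOf y x3 ∧ rr e3 x3 y2 ∧ isSingletonOf y2 u ∧ isSingletonOf s' u ∧
    isSingletonOf s s')
  have jtot : ∀ x, smem x X → ∃ u s' s, isSingletonOf s' u ∧ isSingletonOf s s' ∧ rr j x s := by
    intro x hx
    obtain ⟨x', h1⟩ := he1.2.2.1 x hx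
    obtain ⟨y', h2⟩ := hi.1.2.2.1 x' (func_dom he1 h1).2
    obtain ⟨y, h3⟩ := he2.2.2.1 y' (func_dom hi.1 h2).2
    obtain ⟨x3, h4, h5⟩ := (hY3.2 y).1 (func_dom he2 h3).2
    obtain ⟨y2, h6⟩ := he3.2.2.1 x3 h4
    obtain ⟨u, -, h7⟩ := (hY2.2 y2).1 (func_dom he3 h6).2
    obtain ⟨s', h8⟩ := exists_sing u
    obtain ⟨s, h9⟩ := exists_sing s'
    exact ⟨u, s', s, h8, h9, (hj _ _).2 ⟨x', y', y, x3, y2, u, s', h1, h2, h3, h5, h6, h7, h8, h9⟩⟩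
  have jinj : ∀ x1 x2 s, rr j x1 s → rr j x2 s → x1 = x2 := by
    intro x1 x2 s h h'
    obtain ⟨x', y', y, x3, y2, u, s', h1, h2, h3, h5, h6, h7, h8, h9⟩ := (hj _ _).1 h
    obtain ⟨p', q', q, p3, q2, v, r', k1, k2, k3, k5, k6, k7, k8, k9⟩ := (hj _ _).1 h'
    obtain rfl := sing_inj h9 k9
    obtain rfl := sing_inj h8 k8
    obtain rfl := sing_unique h7 k7
    obtain rfl := he3i _ _ _ h6 k6
    obtain rfl := sing_unique h5 k5
    obtain rfl := he2i _ _ _ h3 k3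
    obtain rfl := hi.2 _ _ _ h2 k2
    exact he1i _ _ _ h1 k1
  obtain ⟨k, -, hk, -⟩ := mkRel (M := M) (fun a t => smem a m ∧ ∃ s y, isSingletonOf t s ∧
    isSingletonOf s (spair y c0) ∧ sset y ∧
    ∀ u, smem u y ↔ ∃ x s' s, hs h a x ∧ isSingletonOf s' u ∧ isSingletonOf s s' ∧ rr j x s)
  have hiff : ∀ a p, hs2 k a p ↔ smem a m ∧ ∃ y, p = spair y c0 ∧ sset y ∧
    ∀ u, smem u y ↔ ∃ x s' s, hs h a x ∧ isSingletonOf s' u ∧ isSingletonOf s s' ∧ rr j x s := by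
    intro a p
    constructor
    · rintro ⟨s, t, hs, ht, hr⟩
      obtain ⟨h1, s', y, h2, h3, h4⟩ := (hk _ _).1 hr
      obtain rfl := sing_inj ht h2
      exact ⟨h1, y, sing_inj hs h3, h4⟩
    · rintro ⟨h1, y, rfl, h2⟩
      obtain ⟨s, hs⟩ := exists_sing (spair y c0)
      obtain ⟨t, ht⟩ := exists_sing s
      exact ⟨s, t, hs, ht, (hk _ _).2 ⟨h1, s, y, ht, hs, h2⟩⟩
  refine ⟨k, ?_, ?_, ?_, ?_⟩
  · intro a ha
    obtain ⟨y, h1, h2⟩ := cmp (M := M) (fun u => ∃ x s' s, hs h a x ∧ isSingletonOf s' u ∧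
      isSingletonOf s s' ∧ rr j x s)
    exact ⟨_, (hiff _ _).2 ⟨ha, y, rfl, h1, h2⟩⟩
  · intro a p hp
    obtain ⟨ha, y, e, -⟩ := (hiff _ _).1 hp
    exact ⟨ha, y, e⟩
  · intro a p p' hp hp'
    obtain ⟨ha, y, rfl, h1, h2⟩ := (hiff _ _).1 hp
    obtain ⟨ha', y', rfl, h1', h2'⟩ := (hiff _ _).1 hp'
    rw [sext h1 h1' fun u => (h2 u).trans (h2' u).symm]
  · intro a a' p hp hp'
    obtain ⟨ha, y, e, h1, h2⟩ := (hiff _ _).1 hp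
    obtain ⟨ha', y', e', h1', h2'⟩ := (hiff _ _).1 hp'
    obtain ⟨rfl, -⟩ := pair_inj (e.symm.trans e')
    obtain ⟨x, hx⟩ := g1 a ha
    obtain ⟨u, s', s, k1, k2, k3⟩ := jtot x (g2 a x hx).2.1
    obtain ⟨x2, s2', s2, l1, l2, l3, l4⟩ := (h2' u).1 ((h2 u).2 ⟨x, s', s, hx, k1, k2, k3⟩)
    obtain rfl := sing_unique k1 l2
    obtain rfl := sing_unique k2 l3
    obtain rfl := jinj _ _ _ k3 l4
    exact g3 _ _ _ hx l1

theorem construct {m B k : M} (htr : ∀ a, smem a m → inBF a ∧ ∀ b, inBF b → erel b a → smem b m)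
    (k1 : ∀ a, smem a m → ∃ p, hs2 k a p) (k2 : ∀ a p, hs2 k a p → smem a m ∧ ∃ y, p = spair y c0)
    (k3 : ∀ a p p', hs2 k a p → hs2 k a p' → p = p')
    (k4 : ∀ a a' p, hs2 k a p → hs2 k a' p → a = a') (hB : ∀ a, smem a B → smem a m)
    (hno : ¬ ∃ d, smem d m ∧ ∀ b, smem b m → (erel b d ↔ smem b B)) :
    ∃ d, inBF d ∧ ∀ b, inBF b → (erel b d ↔ smem b B) := by
  obtain ⟨Z, hZ⟩ : ∃ Z : M, Z = spair c0 c1 := ⟨_, rfl⟩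
  obtain ⟨T, hT⟩ : ∃ T : M, T = spair c1 c1 := ⟨_, rfl⟩
  have hZT : Z ≠ T := by
    rintro rfl
    exact c0_ne (pair_inj (hZ.symm.trans hT)).1
  have hkZ : ∀ a, ¬ hs2 k a Z := fun a h => by
    obtain ⟨-, y, e⟩ := k2 _ _ h
    exact c0_ne (pair_inj (hZ.symm.trans e)).2.symm
  have hkT : ∀ a, ¬ hs2 k a T := fun a h => by
    obtain ⟨-, y, e⟩ := k2 _ _ h
    exact c0_ne (pair_inj (hT.symm.trans e)).2.symm
  clear hZ hT
  obtain ⟨Q, q0, hQ, q2⟩ := mkRel (M := M) (fun p p' => (∃ a b, hs2 k a p ∧ hs2 k b p' ∧ erel a b) ∨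
    (p = Z ∧ ∃ b, hs2 k b p' ∧ hasZero b) ∨ (p' = T ∧ ∃ a, smem a B ∧ hs2 k a p) ∨
    (p = Z ∧ p' = T))
  have Zmin : ∀ p, ¬ rr Q p Z := by
    intro p h
    rcases (hQ _ _).1 h with ⟨a, b, -, h, -⟩ | ⟨-, b, h, -⟩ | ⟨h, -⟩ | ⟨-, h⟩
    · exact hkZ _ h
    · exact hkZ _ h
    · exact hZT h
    · exact hZT h
  have ZT : rr Q Z T := (hQ _ _).2 (Or.inr (Or.inr (Or.inr ⟨rfl, rfl⟩)))
  have predT : ∀ p, rr Q p T ↔ p = Z ∨ ∃ a, smem a B ∧ hs2 k a p := by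
    intro p
    refine (hQ _ _).trans ?_
    constructor
    · rintro (⟨a, b, -, h, -⟩ | ⟨-, b, h, -⟩ | ⟨-, h⟩ | ⟨h, -⟩)
      · exact (hkT _ h).elim
      · exact (hkT _ h).elim
      · exact Or.inr h
      · exact Or.inl h
    · rintro (h | h)
      · exact Or.inr (Or.inr (Or.inr ⟨h, rfl⟩))
      · exact Or.inr (Or.inr (Or.inl ⟨rfl, h⟩))
  have predK : ∀ b p' p, hs2 k b p' → (rr Q p p' ↔ (∃ a, hs2 k a p ∧ erel a b) ∨
      (p = Z ∧ hasZero b)) := by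
    intro b p' p hb
    refine (hQ _ _).trans ?_
    constructor
    · rintro (⟨a, b', h1, h2, h3⟩ | ⟨h1, b', h2, h3⟩ | ⟨h1, -⟩ | ⟨-, h1⟩)
      · obtain rfl := k4 _ _ _ hb h2
        exact Or.inl ⟨a, h1, h3⟩
      · obtain rfl := k4 _ _ _ hb h2
        exact Or.inr ⟨h1, h3⟩
      · subst h1
        exact (hkT _ hb).elim
      · subst h1
        exact (hkT _ hb).elim
    · rintro (⟨a, h1, h2⟩ | ⟨h1, h2⟩)
      · exact Or.inl ⟨a, b, h1, hb, h2⟩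
      · exact Or.inr (Or.inl ⟨h1, b, hb, h2⟩)
  have fieldQ : ∀ p, inField p Q → p = Z ∨ p = T ∨ ∃ a, hs2 k a p := by
    rintro p ⟨p', h | h⟩
    · rcases (hQ _ _).1 h with ⟨a, b, h, -⟩ | ⟨h, -⟩ | ⟨-, a, -, h⟩ | ⟨h, -⟩
      · exact Or.inr (Or.inr ⟨a, h⟩)
      · exact Or.inl h
      · exact Or.inr (Or.inr ⟨a, h⟩)
      · exact Or.inl h
    · rcases (hQ _ _).1 h with ⟨a, b, -, h, -⟩ | ⟨-, b, h, -⟩ | ⟨h, -⟩ | ⟨-, h⟩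
      · exact Or.inr (Or.inr ⟨b, h⟩)
      · exact Or.inr (Or.inr ⟨b, h⟩)
      · exact Or.inr (Or.inl h)
      · exact Or.inr (Or.inl h)
  have simK : ∀ a p R r, hs2 k a p → Rep a R r → Sim R Q r p := by
    intro a p R r hap hR
    refine Sim.of (R := R) (S := Q) (fun u w => ((∀ u', ¬ rr R u' u) ∧ w = Z) ∨
      ∃ a S s, Rep a S s ∧ Sim S R s u ∧ hs2 k a w) ?_ (Or.inr ⟨a, R, r, hR, Sim.refl R r, hap⟩)
      strat
    rintro u w (⟨h1, rfl⟩ | ⟨a, S, s, hS, hsim, hk⟩)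
    · exact ⟨fun u' h => (h1 u' h).elim, fun w' h => (Zmin w' h).elim⟩
    · constructor
      · intro u' hu'
        obtain ⟨s', hs', hsim'⟩ := hsim.bwd hu'
        by_cases hq : ∃ q, rr S q s'
        · obtain ⟨q, hq⟩ := hq
          obtain ⟨a', S', s'', hS', hsim2⟩ := exists_rep hS.1 hq
          have hea : erel a' a := (hS'.erel_iff hS).2 ⟨s', hs', hsim2⟩
          have ham := (htr a (k2 _ _ hk).1).2 a' (inBF_iff.2 ⟨_, _, hS'⟩) hea
          obtain ⟨p', hp'⟩ := k1 a' ham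
          exact ⟨p', (predK _ _ _ hk).2 (Or.inl ⟨a', hp', hea⟩),
            Or.inr ⟨a', S', s'', hS', hsim2.trans hsim', hp'⟩⟩
        · refine ⟨Z, (predK _ _ _ hk).2 (Or.inr ⟨rfl, hS.hasZero_iff.2
            ⟨s', hs', fun q h => hq ⟨q, h⟩⟩⟩), Or.inl ⟨fun v hv => ?_, rfl⟩⟩
          obtain ⟨q, h, -⟩ := hsim'.bwd hv
          exact hq ⟨q, h⟩
      · intro w' hw'
        rcases (predK _ _ _ hk).1 hw' with ⟨a', h1, h2⟩ | ⟨rfl, h2⟩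
        · obtain ⟨S', s', hS'⟩ := inBF_iff.1 (htr a' (k2 _ _ h1).1).1
          obtain ⟨p', h3, h4⟩ := (hS'.erel_iff hS).1 h2
          obtain ⟨u', h5, h6⟩ := hsim.fwd h3
          exact ⟨u', h5, Or.inr ⟨a', S', s', hS', h4.trans h6, h1⟩⟩
        · obtain ⟨p', h3, h4⟩ := hS.hasZero_iff.1 h2
          obtain ⟨u', h5, h6⟩ := hsim.fwd h3
          refine ⟨u', h5, Or.inl ⟨fun v hv => ?_, rfl⟩⟩
          obtain ⟨q, h, -⟩ := h6.bwd hv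
          exact h4 q h
  have repK : ∀ a p, hs2 k a p → ∃ R r, Rep a R r ∧ Sim R Q r p := by
    intro a p h
    obtain ⟨R, r, hR⟩ := inBF_iff.1 (htr a (k2 _ _ h).1).1
    exact ⟨R, r, hR, simK _ _ _ _ h hR⟩
  have predsK : ∀ a p, hs2 k a p → ∃ q, rr Q q p := by
    intro a p h
    obtain ⟨R, r, hR, hsim⟩ := repK a p h
    obtain ⟨q, hq⟩ := top_pred hR.2.1
    obtain ⟨q', h, -⟩ := hsim.fwd hq
    exact ⟨q', h⟩
  have extT : ∀ a p, hs2 k a p → ¬ ∀ c, rr Q c p ↔ rr Q c T := by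
    intro a p hp h
    refine hno ⟨a, (k2 _ _ hp).1, fun b hb => ?_⟩
    obtain ⟨pb, hpb⟩ := k1 b hb
    have hbZ : pb ≠ Z := by
      rintro rfl
      exact hkZ _ hpb
    have := h pb
    rw [predK _ _ _ hp, predT] at this
    constructor
    · intro hba
      rcases this.1 (Or.inl ⟨b, hpb, hba⟩) with h | ⟨b', h1, h2⟩
      · exact (hbZ h).elim
      · rwa [k4 _ _ _ hpb h2]
    · intro hbB
      rcases this.2 (Or.inr ⟨b, hbB, hpb⟩) with ⟨b', h1, h2⟩ | ⟨h, -⟩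
      · rwa [k4 _ _ _ hpb h1]
      · exact (hbZ h).elim
  have hQB : isBFEXT Q := by
    refine ⟨⟨q0, fun p hp => ?_⟩, ?_, ?_⟩
    · obtain ⟨x, y, e, -⟩ := q2 p hp
      exact ⟨x, y, e⟩
    · intro S hS ⟨b, hb⟩ hSQ
      by_contra hcon
      have hcon' : ∀ b, smem b S → ∃ c, smem c S ∧ rr Q c b := by
        intro b hb
        by_contra h
        exact hcon ⟨b, hb, fun c hc hcb => h ⟨c, hc, hcb⟩⟩
      have nZ : ¬ smem Z S := fun h => by
        obtain ⟨c, -, hc⟩ := hcon' Z h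
        exact Zmin c hc
      have nK : ∀ a p, hs2 k a p → ¬ smem p S := by
        intro a p hap hpS
        obtain ⟨R, r, hR, hsim⟩ := repK a p hap
        refine wf_ind hR.1 (fun x => ∀ y, smem y S → ¬ Sim R Q x y) ?_ hR.2.1.1 strat p hpS hsim
        intro x hx ih y hy hxy
        obtain ⟨c, hc, hcy⟩ := hcon' y hy
        obtain ⟨x', hx', hs⟩ := hxy.bwd hcy
        exact ih x' hx' c hc hs
      have onlyT : ∀ p, smem p S → p = T := by
        intro p hp
        rcases fieldQ p (hSQ p hp) with rfl | h | ⟨a, h⟩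
        · exact (nZ hp).elim
        · exact h
        · exact (nK a p h hp).elim
      obtain ⟨c, hc, hcb⟩ := hcon' b hb
      obtain rfl := onlyT b hb
      obtain rfl := onlyT c hc
      rcases (predT _).1 hcb with h | ⟨a, -, h⟩
      · exact hZT h.symm
      · exact hkT _ h
    · intro x y hx hy hxy
      have hxy : ∀ c, rr Q c x ↔ rr Q c y := hxy
      rcases fieldQ x hx with rfl | rfl | ⟨a, ha⟩ <;> rcases fieldQ y hy with rfl | rfl | ⟨b, hb⟩
      · rfl
      · exact (Zmin _ ((hxy _).2 ZT)).elim
      · obtain ⟨q, hq⟩ := predsK _ _ hb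
        exact (Zmin _ ((hxy _).2 hq)).elim
      · exact (Zmin _ ((hxy _).1 ZT)).elim
      · rfl
      · exact (extT _ _ hb fun c => (hxy c).symm).elim
      · obtain ⟨q, hq⟩ := predsK _ _ ha
        exact (Zmin _ ((hxy _).1 hq)).elim
      · exact (extT _ _ ha hxy).elim
      · obtain ⟨R, r, hR, h1⟩ := repK _ _ ha
        obtain ⟨S, s, hS, h2⟩ := repK _ _ hb
        have h3 : Sim Q Q x y := Sim.mk (fun u hu => ⟨u, (hxy u).1 hu, Sim.refl Q u⟩)
          (fun u hu => ⟨u, (hxy u).2 hu, Sim.refl Q u⟩)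
        obtain rfl := (hR.eq_iff hS).2 (h1.trans (h3.trans h2.symm))
        exact k3 _ _ _ ha hb
  have hTf : inField T Q := fieldR ZT
  obtain ⟨sg, hsg⟩ := exists_seg Q T
  obtain ⟨d, hd⟩ := exists_type sg
  have hrep : Rep d sg T := ⟨seg_bfext hQB hsg hTf, seg_top hsg hTf ZT, hd⟩
  refine ⟨d, inBF_iff.2 ⟨_, _, hrep⟩, fun b hb => ?_⟩
  obtain ⟨S, s, hS⟩ := inBF_iff.1 hb
  rw [hS.erel_iff hrep]
  constructor
  · rintro ⟨p, hp, hsim⟩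
    have hpT := ((seg_rr hsg).1 hp).1
    have hsim' : Sim S Q s p := hsim.trans (seg_sim hsg (inSeg_pred (inSeg_self Q T) hpT))
    rcases (predT _).1 hpT with rfl | ⟨a, ha, hap⟩
    · obtain ⟨q, hq⟩ := top_pred hS.2.1
      obtain ⟨q', h, -⟩ := hsim'.fwd hq
      exact (Zmin _ h).elim
    · obtain ⟨R, r, hR, h1⟩ := repK _ _ hap
      rwa [(hS.eq_iff hR).2 (hsim'.trans h1.symm)]
  · intro hbB
    obtain ⟨p, hp⟩ := k1 b (hB b hbB)
    have hpT : rr Q p T := (predT _).2 (Or.inr ⟨b, hbB, hp⟩)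
    refine ⟨p, (seg_rr hsg).2 ⟨hpT, inSeg_self Q T⟩, (simK _ _ _ _ hp hS).trans ?_⟩
    exact (seg_sim hsg (inSeg_pred (inSeg_self Q T) hpT)).symm

end Final

theorem stmt17 :
    ∀ (M : Type) [LNFU.Structure M] [Nonempty M], M ⊨ NFUmAC →
      ∀ g f v cV t4 : M, isMFun g → isBethFun f → isUniverseOf v → isCardOf cV v →
        isT4Of t4 cV →
        ∀ n b : M, isNat n → smem (spair n b) f → ¬ isEmptySet b → cardLe b t4 →
          ∀ mn B : M, smem (spair n mn) g → sset B → (∀ x, smem x B → smem x mn) →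
            ∀ n' mn', isSuccOf n' n → smem (spair n' mn') g →
              ∃ d, smem d mn' ∧ ∀ b', smem b' mn → (erel b' d ↔ smem b' B) := by
  intro M _ _ hM g f v cV t4 hg hf _ _ ht4 n b hn hb hne hle mn B hmn hBs hB n' mn' hs hmn'
  have : NFU M := ⟨hM, inferInstance⟩
  obtain ⟨X, h, z, hc, hgood⟩ := invariant hf hg hn hb hmn hne
  obtain ⟨k, k1, k2, k3, k4⟩ := exists_points hgood hc ht4 hle
  have hsucc := (hg.2.2.2.2.2 n n' mn mn' hn hs hmn hmn').2
  have htr := fun a ha => level_trans (a := a) hg hn hmn ha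
  by_cases hex : ∃ d, smem d mn ∧ ∀ b, smem b mn → (erel b d ↔ smem b B)
  · obtain ⟨d, hd, h⟩ := hex
    exact ⟨d, (hsucc d).2 (htr d hd), h⟩
  · obtain ⟨d, hd, h⟩ := construct htr k1 k2 k3 k4 hB hex
    refine ⟨d, (hsucc d).2 ⟨hd, fun b hb hbd => hB b ((h b hb).1 hbd)⟩, fun b hb => ?_⟩
    exact h b (htr b hb).1

end NFUweak
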